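/- Let (W, S) be a finite Coxeter system with longest element w₀ and fix a reduced word ω₀ for w₀. Then two maximal chains C and C' of the right weak order on W satisfy inv_{ω₀}(C) = inv_{ω₀}(C') if and only if C and C' are square-equivalent. -/

import Mathlib

/-! Generic order-theoretic definitions: covering relations, intervals, maximal
chains in subposets, polygons, polygon/square moves, square-equivalence,
ascending chains with respect to an edge labelling, increasing polygon moves,
and the induced preorder on (square-equivalence classes of) maximal chains. -/

section GenericOrder

variable {α : Type*}

/-- `b` covers `a` with respect to the relation `r`. -/
def CovR (r : α → α → Prop) (a b : α) : Prop :=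
  r a b ∧ a ≠ b ∧ ∀ z, r a z → r z b → z = a ∨ z = b

/-- The closed interval from `x` to `y` with respect to `r`. -/
def IccR (r : α → α → Prop) (x y : α) : Set α := {z | r x z ∧ r z y}

/-- `C` is a maximal chain of the subposet `S` (with respect to `r`). -/
def MaxChainIn (r : α → α → Prop) (S C : Set α) : Prop :=
  C ⊆ S ∧ IsChain r C ∧ ∀ C' : Set α, C' ⊆ S → IsChain r C' → C ⊆ C' → C = C'

/-- `(x, y, C₁, C₂)` form a polygon: the interval `[x, y]` has exactly the two
distinct maximal chains `C₁ ≠ C₂`, whose union is the interval and whose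
intersection is `{x, y}`. -/
def IsPolygonPair (r : α → α → Prop) (x y : α) (C₁ C₂ : Set α) : Prop :=
  r x y ∧ MaxChainIn r (IccR r x y) C₁ ∧ MaxChainIn r (IccR r x y) C₂ ∧
    C₁ ≠ C₂ ∧ IccR r x y = C₁ ∪ C₂ ∧ C₁ ∩ C₂ = {x, y} ∧
    ∀ C : Set α, MaxChainIn r (IccR r x y) C → C = C₁ ∨ C = C₂

/-- `P` is a polygon with respect to `r`. -/
def IsPolygon (r : α → α → Prop) (P : Set α) : Prop :=
  ∃ x y C₁ C₂, P = IccR r x y ∧ IsPolygonPair r x y C₁ C₂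

/-- `C` and `C'` are related by a polygon move. -/
def PolygonMove (r : α → α → Prop) (C C' : Set α) : Prop :=
  ∃ x y P₁ P₂, IsPolygonPair r x y P₁ P₂ ∧ P₁ ⊆ C ∧ P₂ ⊆ C' ∧ C \ P₁ = C' \ P₂

/-- `C` and `C'` are related by a square move: a polygon move across a
four-element polygon. -/
def SquareMove (r : α → α → Prop) (C C' : Set α) : Prop :=
  ∃ x y P₁ P₂, IsPolygonPair r x y P₁ P₂ ∧ (IccR r x y).ncard = 4 ∧
    P₁ ⊆ C ∧ P₂ ⊆ C' ∧ C \ P₁ = C' \ P₂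

/-- Square-equivalence: the reflexive-transitive closure of square moves. -/
def SqEquiv (r : α → α → Prop) : Set α → Set α → Prop :=
  Relation.ReflTransGen (SquareMove r)

/-- The chain `C` has strictly increasing edge labels (with respect to the
strict order `lt` on labels): for any two covering pairs occurring along `C`,
the earlier one has strictly smaller label. -/
def ChainAscending {E : Type*} (r : α → α → Prop) (lab : α → α → E)
    (lt : E → E → Prop) (C : Set α) : Prop :=
  ∀ a b c d, a ∈ C → b ∈ C → c ∈ C → d ∈ C →
    CovR r a b → CovR r c d → r b c → lt (lab a b) (lab c d)

/-- `C'` is an increasing polygon move of `C`: they differ by a polygon move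
across a non-square polygon, with `C` containing the ascending chain. -/
def IncPolygonMove {E : Type*} (r : α → α → Prop) (lab : α → α → E)
    (lt : E → E → Prop) (C C' : Set α) : Prop :=
  ∃ x y P₁ P₂, IsPolygonPair r x y P₁ P₂ ∧ (IccR r x y).ncard ≠ 4 ∧
    P₁ ⊆ C ∧ P₂ ⊆ C' ∧ C \ P₁ = C' \ P₂ ∧ ChainAscending r lab lt P₁

/-- The preorder `≼` on (square-equivalence classes of) maximal chains: the
smallest preorder generated by square moves and increasing polygon moves. -/
def MGPre {E : Type*} (r : α → α → Prop) (lab : α → α → E) (lt : E → E → Prop) :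
    Set α → Set α → Prop :=
  Relation.ReflTransGen (fun A B => SqEquiv r A B ∨ IncPolygonMove r lab lt A B)

/-- `[C'] covers [C]` in the preorder `≼` on square-equivalence classes of
maximal chains: `[C] ≺ [C']` and every class weakly between them equals `[C]`
or `[C']`. -/
def MGCover {E : Type*} (r : α → α → Prop) (lab : α → α → E) (lt : E → E → Prop)
    (C C' : Set α) : Prop :=
  MGPre r lab lt C C' ∧ ¬ MGPre r lab lt C' C ∧
    ∀ D : Set α, IsMaxChain r D → MGPre r lab lt C D → MGPre r lab lt D C' →
      SqEquiv r D C ∨ SqEquiv r D C'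

/-- The labelling is polygon-complete: increasing polygon moves always give
covering relations of the preorder on square-equivalence classes. -/
def PolygonComplete {E : Type*} (r : α → α → Prop) (lab : α → α → E)
    (lt : E → E → Prop) : Prop :=
  ∀ C C' : Set α, IsMaxChain r C → IsMaxChain r C' → IncPolygonMove r lab lt C C' →
    MGCover r lab lt C C'

end GenericOrder

/-! Coxeter-specific definitions: the right weak order, its labelling by
reflections, commutation moves, heap posets of reduced words, and (maximal)
dihedral reflection subgroups. -/

section CoxeterDefs

variable {B : Type*} {W : Type*} [Group W] {M : CoxeterMatrix B}

/-- The right weak Bruhat order: `u ≤ w` iff `ℓ(u) + ℓ(u⁻¹ w) = ℓ(w)`. -/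
def weakLE (cs : CoxeterSystem M W) (u w : W) : Prop :=
  cs.length u + cs.length (u⁻¹ * w) = cs.length w

/-- The set of labels of the covering relations of a chain `C` in the right
weak order: the covering relation `v ⋖ v s` is labelled by the reflection
`v s v⁻¹`, i.e. the cover `u ⋖ w` is labelled by `w * u⁻¹`. -/
def chainLabels (cs : CoxeterSystem M W) (C : Set W) : Set W :=
  {t | ∃ u w : W, u ∈ C ∧ w ∈ C ∧ CovR (weakLE cs) u w ∧ t = w * u⁻¹}

/-- `ω'` is obtained from `ω` by one commutation move: swapping an adjacent
pair of commuting letters. -/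
def CommMove (cs : CoxeterSystem M W) (ω ω' : List B) : Prop :=
  ∃ (l r : List B) (i j : B),
    cs.simple i * cs.simple j = cs.simple j * cs.simple i ∧
    ω = l ++ i :: j :: r ∧ ω' = l ++ j :: i :: r

/-- The strict heap order of a word `ω`: the transitive closure of the
relations `t_j < t_k` for `j < k` in the (left) inversion sequence of `ω`
whenever `t_j` and `t_k` do not commute. -/
def heapLt (cs : CoxeterSystem M W) (ω : List B) : W → W → Prop :=
  Relation.TransGen (fun a b => ∃ j k : ℕ, j < k ∧
    (cs.leftInvSeq ω)[j]? = some a ∧ (cs.leftInvSeq ω)[k]? = some b ∧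
    a * b ≠ b * a)

/-- A dihedral reflection subgroup: a subgroup generated by two reflections. -/
def IsDihedralSubgroup (cs : CoxeterSystem M W) (D : Subgroup W) : Prop :=
  ∃ t₁ t₂ : W, cs.IsReflection t₁ ∧ cs.IsReflection t₂ ∧
    D = Subgroup.closure {t₁, t₂}

/-- A maximal dihedral reflection subgroup: maximal under inclusion among
dihedral reflection subgroups. -/
def IsMaxDihedralSubgroup (cs : CoxeterSystem M W) (D : Subgroup W) : Prop :=
  IsDihedralSubgroup cs D ∧
    ∀ D' : Subgroup W, IsDihedralSubgroup cs D' → D ≤ D' → D = D'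

/-- The set of reflections of `W` contained in a subgroup `D`. -/
def reflectionsIn (cs : CoxeterSystem M W) (D : Subgroup W) : Set W :=
  {t | cs.IsReflection t ∧ t ∈ D}

/-- `D` contains two non-commuting reflections. -/
def IsNonCommutative (cs : CoxeterSystem M W) (D : Subgroup W) : Prop :=
  ∃ t t' : W, cs.IsReflection t ∧ cs.IsReflection t' ∧ t ∈ D ∧ t' ∈ D ∧
    t * t' ≠ t' * t

/-- `t` occurs strictly before `t'` in the inversion sequence of `ω`. -/
def seqBefore (cs : CoxeterSystem M W) (ω : List B) (t t' : W) : Prop :=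
  ∃ j k : ℕ, j < k ∧ (cs.leftInvSeq ω)[j]? = some t ∧
    (cs.leftInvSeq ω)[k]? = some t'

/-- `t` occurs strictly before `t'` in the label sequence of the chain `C`
of the right weak order. -/
def chainBefore (cs : CoxeterSystem M W) (C : Set W) (t t' : W) : Prop :=
  ∃ a b c d : W, a ∈ C ∧ b ∈ C ∧ c ∈ C ∧ d ∈ C ∧
    CovR (weakLE cs) a b ∧ CovR (weakLE cs) c d ∧
    t = b * a⁻¹ ∧ t' = d * c⁻¹ ∧ weakLE cs b c

/-- The inversion set `inv_ω(C)` of a maximal chain `C`: the set of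
non-commutative maximal dihedral reflection subgroups whose reflections occur
in the label sequence of `C` in a different relative order from the inversion
sequence of `ω`. -/
def invSubgroups (cs : CoxeterSystem M W) (ω : List B) (C : Set W) :
    Set (Subgroup W) :=
  {D | IsMaxDihedralSubgroup cs D ∧ IsNonCommutative cs D ∧
    ∃ t t' : W, cs.IsReflection t ∧ cs.IsReflection t' ∧ t ∈ D ∧ t' ∈ D ∧
      seqBefore cs ω t t' ∧ chainBefore cs C t' t}

end CoxeterDefs

namespace WeakChains

section Exchange

variable {B : Type*} {W : Type*} [Group W] {M : CoxeterMatrix B} (cs : CoxeterSystem M W)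

open Classical in
/-- The signed permutation attached to a simple reflection. -/
noncomputable def flipFun (i : B) (x : W × ZMod 2) : W × ZMod 2 :=
  (cs.simple i * x.1 * cs.simple i, x.2 + if x.1 = cs.simple i then 1 else 0)

theorem flipFun_flipFun (i : B) (x : W × ZMod 2) : flipFun cs i (flipFun cs i x) = x := by
  obtain ⟨t, e⟩ := x
  have h : (cs.simple i * t * cs.simple i = cs.simple i) ↔ t = cs.simple i := by
    constructor
    · intro h
      have := congrArg (fun z => cs.simple i * z * cs.simple i) h
      simpa [mul_assoc] using this
    · rintro rfl; simp
  have h2 : (1 : ZMod 2) + 1 = 0 := by decide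
  simp only [flipFun, h]
  ext
  · simp [mul_assoc]
  · by_cases ht : t = cs.simple i
    · simp [ht, add_assoc, h2]
    · have h' := mt h.1 ht
      simp [ht, h']

/-- The signed permutation as an equivalence. -/
noncomputable def flipPerm (i : B) : Equiv.Perm (W × ZMod 2) :=
  ⟨flipFun cs i, flipFun cs i, flipFun_flipFun cs i, flipFun_flipFun cs i⟩

open Classical in
theorem flip_pow (i j : B) (m : ℕ) (t : W) (e : ZMod 2) :
    ((flipPerm cs i * flipPerm cs j) ^ m) (t, e) =
      ((cs.simple i * cs.simple j) ^ m * t * ((cs.simple i * cs.simple j) ^ m)⁻¹,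
        e + ∑ k ∈ Finset.range (2 * m),
          if t = cs.simple j * (cs.simple i * cs.simple j) ^ k then 1 else 0) := by
  induction m with
  | zero => simp
  | succ m ih =>
    rw [pow_succ', Equiv.Perm.mul_apply, ih]
    set c := cs.simple i * cs.simple j with hc
    have hjc : cs.simple j * c * cs.simple j = c⁻¹ := by simp [hc, mul_assoc]
    have hjck : ∀ k : ℕ, cs.simple j * c ^ k * cs.simple j = (c ^ k)⁻¹ := by
      intro k
      have : cs.simple j * c ^ k * (cs.simple j)⁻¹ = (cs.simple j * c * (cs.simple j)⁻¹) ^ k := by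
        rw [conj_pow]
      rw [cs.inv_simple, hjc] at this
      rw [this, inv_pow]
    have hjck' : ∀ k : ℕ, (c ^ k)⁻¹ * cs.simple j = cs.simple j * c ^ k := by
      intro k
      rw [← hjck]; simp [mul_assoc]
    have e1 : (c ^ m * t * (c ^ m)⁻¹ = cs.simple j) ↔ t = cs.simple j * c ^ (2 * m) := by
      rw [two_mul, pow_add, ← mul_assoc, ← hjck']
      constructor
      · intro h; rw [← h]; group
      · intro h; rw [h]; group
    have e2 : (cs.simple j * (c ^ m * t * (c ^ m)⁻¹) * cs.simple j = cs.simple i) ↔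
        t = cs.simple j * c ^ (2 * m + 1) := by
      have : cs.simple j * c ^ (2 * m + 1) = (c ^ m)⁻¹ * (cs.simple j * c) * c ^ m := by
        rw [← mul_assoc, hjck', show 2 * m + 1 = m + 1 + m by ring, pow_add, pow_succ]
        simp only [mul_assoc]
      rw [this]
      have hc' : cs.simple j * c = cs.simple j * cs.simple i * cs.simple j := by
        rw [hc, mul_assoc]
      rw [hc']
      generalize c ^ m = d
      constructor
      · intro h; rw [← h]; simp [mul_assoc]
      · intro h; rw [h]; simp [mul_assoc]
    rw [Equiv.Perm.mul_apply]
    change flipFun cs i (flipFun cs j _) = _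
    simp only [flipFun]
    rw [show 2 * (m + 1) = 2 * m + 1 + 1 by ring, Finset.sum_range_succ, Finset.sum_range_succ]
    simp only [e1, e2]
    ext
    · simp [hc, pow_succ', mul_assoc]
    · simp only [add_assoc]

theorem flip_liftable : CoxeterMatrix.IsLiftable M (flipPerm cs) := by
  classical
  intro i j
  ext1 x
  obtain ⟨t, e⟩ := x
  rw [flip_pow, two_mul, Finset.sum_range_add]
  simp only [pow_add, cs.simple_mul_simple_pow, one_mul]
  have h2 : ∀ z : ZMod 2, z + z = 0 := by decide
  rw [h2]
  simp

/-- The signed permutation representation. -/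
noncomputable def flipHom : W →* Equiv.Perm (W × ZMod 2) :=
  cs.lift ⟨flipPerm cs, flip_liftable cs⟩

theorem flipHom_simple (i : B) : flipHom cs (cs.simple i) = flipPerm cs i :=
  cs.lift_apply_simple (flip_liftable cs) i

theorem flipHom_apply (w t : W) (e : ZMod 2) :
    flipHom cs w (t, e) = (w * t * w⁻¹, e + (flipHom cs w (t, 0)).2) := by
  induction w using cs.simple_induction_left generalizing t e with
  | one => simp
  | mul_simple_left w i ih =>
    rw [map_mul, Equiv.Perm.mul_apply, Equiv.Perm.mul_apply, ih t e, ih t 0, flipHom_simple]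
    change flipFun cs i _ = (_, e + (flipFun cs i _).2)
    simp [flipFun, mul_assoc, add_assoc]

/-- Parity of the number of occurrences of `t` in the left inversion sequence of `w`. -/
noncomputable def par (w t : W) : ZMod 2 := (flipHom cs w⁻¹ (t, 0)).2

theorem par_mul (v w t : W) : par cs (v * w) t = par cs v t + par cs w (v⁻¹ * t * v) := by
  unfold par
  rw [mul_inv_rev, map_mul, Equiv.Perm.mul_apply, flipHom_apply cs v⁻¹ t 0, flipHom_apply cs w⁻¹]
  simp

theorem par_one (t : W) : par cs 1 t = 0 := by simp [par]

open Classical in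
theorem par_simple (i : B) (t : W) : par cs (cs.simple i) t = if t = cs.simple i then 1 else 0 := by
  unfold par
  rw [cs.inv_simple, flipHom_simple]
  change (flipFun cs i _).2 = _
  simp [flipFun]

theorem par_refl {t : W} (ht : cs.IsReflection t) : par cs t t = 1 := by
  obtain ⟨v, i, rfl⟩ := ht
  have h := par_mul cs v v⁻¹ (v * cs.simple i * v⁻¹)
  rw [mul_inv_cancel, par_one] at h
  rw [par_mul, par_mul, par_simple]
  simp only [mul_assoc, inv_mul_cancel_left, inv_mul_cancel, mul_one, mul_inv_rev,
    CoxeterSystem.inv_simple, CoxeterSystem.simple_mul_simple_self] at h ⊢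
  simp only [if_true]
  rw [add_right_comm, ← h, zero_add]

theorem mem_of_par {ω : List B} {t : W} (h : par cs (cs.wordProd ω) t ≠ 0) :
    t ∈ cs.leftInvSeq ω := by
  classical
  induction ω generalizing t with
  | nil => simp [par_one] at h
  | cons i ω ih =>
    rw [cs.wordProd_cons, par_mul, par_simple] at h
    simp only [CoxeterSystem.leftInvSeq, List.mem_cons, List.mem_map]
    by_cases ht : t = cs.simple i
    · exact Or.inl ht
    · right
      simp only [ht, if_false, zero_add] at h
      exact ⟨_, ih h, by simp [mul_assoc]⟩

theorem strong_exchange {ω : List B} {t : W} (h : cs.IsLeftInversion (cs.wordProd ω) t) :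
    t ∈ cs.leftInvSeq ω := by
  apply mem_of_par
  intro h0
  obtain ⟨ht, hl⟩ := h
  obtain ⟨ω', hω', he⟩ := cs.exists_isReduced (t * cs.wordProd ω)
  have h1 : par cs (t * cs.wordProd ω) t ≠ 0 := by
    rw [par_mul, par_refl cs ht]
    simp [h0]
  rw [he] at h1
  have := (cs.isLeftInversion_of_mem_leftInvSeq hω' (mem_of_par cs h1)).2
  rw [← he, ← mul_assoc, ht.mul_self, one_mul] at this
  omega

theorem lis_append (l r : List B) : cs.leftInvSeq (l ++ r) =
    cs.leftInvSeq l ++ (cs.leftInvSeq r).map (MulAut.conj (cs.wordProd l)) := by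
  induction l with
  | nil => simp
  | cons i l ih =>
    simp [CoxeterSystem.leftInvSeq, ih, cs.wordProd_cons]

theorem inv_subadd {v w t : W} (h : cs.IsLeftInversion (v * w) t) :
    cs.IsLeftInversion v t ∨ cs.IsLeftInversion w (v⁻¹ * t * v) := by
  obtain ⟨a, ha, rfl⟩ := cs.exists_isReduced v
  obtain ⟨b, hb, rfl⟩ := cs.exists_isReduced w
  rw [← cs.wordProd_append] at h
  have := strong_exchange cs h
  rw [lis_append, List.mem_append, List.mem_map] at this
  rcases this with h | ⟨x, hx, rfl⟩
  · exact Or.inl (cs.isLeftInversion_of_mem_leftInvSeq ha h)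
  · right
    simpa [mul_assoc] using (cs.isLeftInversion_of_mem_leftInvSeq hb hx)

theorem inv_simple_eq {i : B} {t : W} (h : cs.IsLeftInversion (cs.simple i) t) :
    t = cs.simple i := by
  have h : cs.IsLeftInversion (cs.wordProd [i]) t := by simpa using h
  simpa using strong_exchange cs h

theorem refl_inv_self {t : W} (h : cs.IsReflection t) : cs.IsLeftInversion t t := by
  refine ⟨h, ?_⟩
  rw [h.mul_self, cs.length_one]
  exact h.odd_length.pos

end Exchange

section Dihedral

variable {B : Type*} {W : Type*} [Group W] {M : CoxeterMatrix B} (cs : CoxeterSystem M W)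

/-- Canonical generators of a reflection subgroup. -/
def Chi (D : Subgroup W) (t : W) : Prop :=
  cs.IsReflection t ∧ t ∈ D ∧ ∀ r ∈ D, cs.IsLeftInversion t r → r = t

/-- Lists of reflections that look like an inversion sequence of `D`. -/
inductive Good (D : Subgroup W) : List W → Prop
  | nil : Good D []
  | cons (a : W) (l : List W) : Chi cs D a → a ∉ l → Good D (l.map (MulAut.conj a)) →
      Good D (a :: l)

theorem chi_conj {D E : Subgroup W} {i : B} (hi : cs.simple i ∉ D)
    (hE : ∀ x, x ∈ E ↔ MulAut.conj (cs.simple i) x ∈ D) {t : W} (ht : Chi cs E t) :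
    Chi cs D (MulAut.conj (cs.simple i) t) := by
  obtain ⟨h1, h2, h3⟩ := ht
  refine ⟨h1.conj _, (hE t).1 h2, ?_⟩
  intro r hr hinv
  have hrE : cs.simple i * r * cs.simple i ∈ E := by
    rw [hE]; simpa [mul_assoc] using hr
  rw [MulAut.conj_apply, cs.inv_simple, mul_assoc] at hinv
  rcases inv_subadd cs hinv with h | h
  · exact absurd (inv_simple_eq cs h ▸ hr) hi
  · rw [cs.inv_simple] at h
    rcases inv_subadd cs h with h | h
    · rw [← h3 _ hrE h]; simp [mul_assoc]
    · have := inv_simple_eq cs h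
      have h4 : cs.simple i ∈ E := by
        rw [← this]
        exact E.mul_mem (E.mul_mem (E.inv_mem h2) hrE) h2
      rw [hE] at h4
      simp at h4
      exact absurd h4 hi

theorem good_conj {D E : Subgroup W} {i : B} (hi : cs.simple i ∉ D)
    (hE : ∀ x, x ∈ E ↔ MulAut.conj (cs.simple i) x ∈ D) {l : List W} (hl : Good cs E l) :
    Good cs D (l.map (MulAut.conj (cs.simple i))) := by
  induction hl with
  | nil => exact Good.nil
  | cons a l ha hal _ ih =>
    rw [List.map_cons]
    refine Good.cons _ _ (chi_conj cs hi hE ha) ?_ ?_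
    · rw [List.mem_map]
      rintro ⟨x, hx, he⟩
      exact hal ((MulAut.conj (cs.simple i)).injective he ▸ hx)
    · convert ih using 1
      rw [List.map_map, List.map_map]
      apply List.map_congr_left
      intro x _
      simp [mul_assoc]

open Classical in
theorem good_filter {ω : List B} (hω : cs.IsReduced ω) (D : Subgroup W) :
    Good cs D ((cs.leftInvSeq ω).filter (fun x => decide (x ∈ D))) := by
  induction ω generalizing D with
  | nil => exact Good.nil
  | cons i ω ih =>
    have hnd := hω.nodup_leftInvSeq
    have hω' : cs.IsReduced ω := by simpa using hω.drop 1
    have ih := ih hω'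
    simp only [CoxeterSystem.leftInvSeq, List.nodup_cons] at hnd ⊢
    by_cases hi : cs.simple i ∈ D
    · rw [List.filter_cons_of_pos (by simpa using hi), List.filter_map]
      refine Good.cons _ _ ⟨cs.isReflection_simple i, hi, fun r _ h => inv_simple_eq cs h⟩ ?_ ?_
      · intro h
        apply hnd.1
        rw [List.mem_map] at h ⊢
        obtain ⟨x, hx, he⟩ := h
        exact ⟨x, (List.mem_filter.1 hx).1, he⟩
      · convert ih D using 1
        rw [List.map_map]
        have : (⇑(MulAut.conj (cs.simple i)) ∘ ⇑(MulAut.conj (cs.simple i))) = id := by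
          ext x; simp [mul_assoc]
        rw [this, List.map_id]
        apply List.filter_congr
        intro x _
        simp only [Function.comp]
        rw [decide_eq_decide, MulAut.conj_apply, D.mul_mem_cancel_right (D.inv_mem hi), D.mul_mem_cancel_left hi]
    · rw [List.filter_cons_of_neg (by simpa using hi), List.filter_map]
      have := ih (D.comap (MulAut.conj (cs.simple i)).toMonoidHom)
      exact good_conj cs hi (fun x => by simp) this

theorem chi_three {D : Subgroup W} {p q r : W} (hp : Chi cs D p) (hq : Chi cs D q)
    (hr : Chi cs D r) (hx : cs.IsReflection (p * q * r)) : p = q ∨ q = r ∨ p = r := by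
  have h := refl_inv_self cs hx
  have hpp := hp.1.mul_self
  have hqq := hq.1.mul_self
  have hrr := hr.1.mul_self
  have pD := hp.2.1
  have qD := hq.2.1
  have rD := hr.2.1
  have hxD : p * q * r ∈ D := D.mul_mem (D.mul_mem pD qD) rD
  nth_rewrite 1 [mul_assoc] at h
  rcases inv_subadd cs h with h | h
  · have := hp.2.2 _ hxD h
    right; left
    rw [mul_assoc, mul_eq_left] at this
    rw [← hr.1.inv]; exact eq_inv_of_mul_eq_one_left this
  · have e : p⁻¹ * (p * q * r) * p = q * r * p := by group
    rw [e] at h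
    rcases inv_subadd cs h with h | h
    · have := hq.2.2 _ (D.mul_mem (D.mul_mem qD rD) pD) h
      right; right
      rw [mul_assoc, mul_eq_left] at this
      rw [← hp.1.inv]; exact (eq_inv_of_mul_eq_one_left this).symm
    · have e : q⁻¹ * (q * r * p) * q = r * p * q := by group
      rw [e] at h
      have := hr.2.2 _ (D.mul_mem (D.mul_mem rD pD) qD) h
      left
      rw [mul_assoc, mul_eq_left] at this
      rw [← hq.1.inv]; exact eq_inv_of_mul_eq_one_left this

theorem dihedral_three {D : Subgroup W} (hD : IsDihedralSubgroup cs D) {p q r : W}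
    (hp : cs.IsReflection p) (hq : cs.IsReflection q) (hr : cs.IsReflection r)
    (pD : p ∈ D) (qD : q ∈ D) (rD : r ∈ D) : cs.IsReflection (p * q * r) := by
  obtain ⟨a, b, ha, hb, rfl⟩ := hD
  have hpar : ∀ {t : W}, cs.IsReflection t → cs.lengthParity t = Multiplicative.ofAdd 1 := by
    rintro _ ⟨w, i, rfl⟩
    simp [cs.lengthParity_simple]
  have haa := ha.mul_self
  have hbb := hb.mul_self
  have hinv : ∀ k : ℤ, a * (a * b) ^ k = (a * b) ^ (-k) * a := by
    intro k
    have h1 : a * (a * b) * a⁻¹ = (a * b)⁻¹ := by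
      rw [← mul_assoc, haa, mul_inv_rev, ha.inv, hb.inv, one_mul]
    have h2 : a * (a * b) ^ k * a⁻¹ = (a * b) ^ (-k) := by
      rw [← conj_zpow, h1, inv_zpow, zpow_neg]
    rw [← h2]; group
  have key : ∀ x ∈ Subgroup.closure {a, b},
      (∃ k : ℤ, x = (a * b) ^ k) ∨ (∃ k : ℤ, x = (a * b) ^ k * a) := by
    intro x hx
    induction hx using Subgroup.closure_induction with
    | mem x hx =>
      rcases hx with rfl | hx
      · exact Or.inr ⟨0, by simp⟩
      · rw [Set.mem_singleton_iff] at hx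
        subst hx
        refine Or.inr ⟨-1, ?_⟩
        rw [zpow_neg_one, mul_inv_rev, ha.inv, hb.inv, mul_assoc, haa, mul_one]
    | one => exact Or.inl ⟨0, by simp⟩
    | mul x y _ _ hx hy =>
      rcases hx with ⟨k, rfl⟩ | ⟨k, rfl⟩ <;> rcases hy with ⟨l, rfl⟩ | ⟨l, rfl⟩
      · exact Or.inl ⟨k + l, by rw [zpow_add]⟩
      · exact Or.inr ⟨k + l, by rw [zpow_add, mul_assoc]⟩
      · exact Or.inr ⟨k - l, by rw [mul_assoc, hinv, ← mul_assoc, sub_eq_add_neg, zpow_add]⟩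
      · refine Or.inl ⟨k - l, ?_⟩
        rw [mul_assoc, ← mul_assoc a, hinv, mul_assoc, haa, mul_one, sub_eq_add_neg, zpow_add]
    | inv x _ hx =>
      rcases hx with ⟨k, rfl⟩ | ⟨k, rfl⟩
      · exact Or.inl ⟨-k, by rw [zpow_neg]⟩
      · refine Or.inr ⟨k, ?_⟩
        rw [mul_inv_rev, ha.inv, ← zpow_neg, hinv, neg_neg]
  have hx := Subgroup.mul_mem _ (Subgroup.mul_mem _ pD qD) rD
  rcases key _ hx with ⟨k, hk⟩ | ⟨k, hk⟩
  · exfalso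
    have := congrArg cs.lengthParity hk
    rw [map_mul, map_mul, map_zpow, map_mul, hpar hp, hpar hq, hpar hr, hpar ha, hpar hb] at this
    have e : (Multiplicative.ofAdd (1 : ZMod 2)) * Multiplicative.ofAdd 1 = 1 := by decide
    rw [e, one_zpow, one_mul] at this
    exact absurd this (by decide)
  · rw [hk]
    rcases Int.even_or_odd' k with ⟨j, rfl | rfl⟩
    · have := ha.conj ((a * b) ^ j)
      convert this using 1
      rw [two_mul, zpow_add, ← zpow_neg, mul_assoc, mul_assoc, hinv, neg_neg]
    · have := (hb.conj a).conj ((a * b) ^ j)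
      convert this using 1
      have e : a * b * a⁻¹ * ((a * b) ^ j)⁻¹ = (a * b) ^ (j + 1) * a := by
        rw [← zpow_neg, mul_assoc, ha.inv, hinv, neg_neg, add_comm, zpow_add, zpow_one]
        simp only [mul_assoc]
      rw [mul_assoc ((a * b) ^ j), e, ← mul_assoc, ← zpow_add]
      congr 2; ring

theorem chi_dihedral {D : Subgroup W} (hD : IsDihedralSubgroup cs D) {p q r : W}
    (hp : Chi cs D p) (hq : Chi cs D q) (hr : Chi cs D r) : p = q ∨ q = r ∨ p = r :=
  chi_three cs hp hq hr
    (dihedral_three cs hD hp.1 hq.1 hr.1 hp.2.1 hq.2.1 hr.2.1)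

theorem conj_eq_self {a b : W} (h : MulAut.conj a b = a) : b = a := by
  rw [MulAut.conj_apply, mul_inv_eq_iff_eq_mul] at h
  exact mul_left_cancel h

theorem good_unique {D : Subgroup W} (hD : IsDihedralSubgroup cs D) {l : List W}
    (h : Good cs D l) : ∀ l' : List W, Good cs D l' → l.length = l'.length →
      l.head? = l'.head? → l = l' := by
  induction h with
  | nil => intro l' _ hlen _; simpa using hlen.symm
  | cons a l ha hal hg ih =>
    intro l' hl' hlen hhead
    cases hl' with
    | nil => simp at hlen
    | cons a' l' ha' hal' hg' =>
      simp only [List.head?_cons, Option.some.injEq] at hhead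
      subst hhead
      have hlen' : l.length = l'.length := by simpa using hlen
      have := ih _ hg' (by simpa using hlen') ?_
      · rw [(MulAut.conj a).injective.list_map this]
      · cases l with
        | nil =>
          cases l' with
          | nil => rfl
          | cons c l' => simp at hlen'
        | cons b l =>
          cases l' with
          | nil => simp at hlen'
          | cons c l' =>
            simp only [List.map_cons, List.head?_cons, Option.some.injEq]
            rw [List.map_cons] at hg hg'
            cases hg with
            | cons _ _ hb _ _ =>
            cases hg' with
            | cons _ _ hc _ _ =>
            rcases chi_dihedral cs hD ha hb hc with h | h | h
            · exact absurd (conj_eq_self h.symm) (fun h => hal (by simp [h]))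
            · exact h
            · exact absurd (conj_eq_self h.symm) (fun h => hal' (by simp [h]))

theorem good_head {D : Subgroup W} {l : List W} {a : W} (h : Good cs D l) (ha : l.head? = some a) :
    Chi cs D a := by
  cases h with
  | nil => simp at ha
  | cons b l hb _ _ => simp at ha; exact ha ▸ hb

theorem good_dichotomy {D : Subgroup W} (hD : IsDihedralSubgroup cs D) {l l' : List W}
    (h : Good cs D l) (h' : Good cs D l') (hlen : l.length = l'.length)
    (hmem : ∀ x, x ∈ l ↔ x ∈ l') :
    l = l' ∨ ∃ p q, List.Sublist [p, q] l ∧ List.Sublist [q, p] l' := by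
  by_cases hh : l.head? = l'.head?
  · exact Or.inl (good_unique cs hD h _ h' hlen hh)
  · right
    cases l with
    | nil =>
      cases l' with
      | nil => simp at hh
      | cons => simp at hlen
    | cons p l =>
      cases l' with
      | nil => simp at hlen
      | cons q l' =>
        have hpq : p ≠ q := by simpa using hh
        refine ⟨p, q, ?_, ?_⟩
        · rw [List.cons_sublist_cons, List.singleton_sublist]
          have := (hmem q).2 (by simp)
          simpa [hpq.symm] using this
        · rw [List.cons_sublist_cons, List.singleton_sublist]
          have := (hmem p).1 (by simp)
          simpa [hpq] using this

theorem good_third {D : Subgroup W} (hD : IsDihedralSubgroup cs D) {l l₁ l₂ : List W}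
    (h : Good cs D l) (h₁ : Good cs D l₁) (h₂ : Good cs D l₂) (hlen₁ : l.length = l₁.length)
    (hlen₂ : l.length = l₂.length) (hne₁ : l ≠ l₁) (hne₂ : l ≠ l₂) : l₁ = l₂ := by
  apply good_unique cs hD h₁ _ h₂ (hlen₁.symm.trans hlen₂)
  have n₁ : l.head? ≠ l₁.head? := fun e => hne₁ (good_unique cs hD h _ h₁ hlen₁ e)
  have n₂ : l.head? ≠ l₂.head? := fun e => hne₂ (good_unique cs hD h _ h₂ hlen₂ e)
  cases l with
  | nil => exact absurd (List.length_eq_zero_iff.1 hlen₁.symm).symm hne₁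
  | cons a l =>
    cases l₁ with
    | nil => simp at hlen₁
    | cons b l₁ =>
      cases l₂ with
      | nil => simp at hlen₂
      | cons c l₂ =>
        simp only [List.head?_cons, Option.some.injEq, ne_eq] at n₁ n₂ ⊢
        rcases chi_dihedral cs hD (good_head cs h rfl) (good_head cs h₁ rfl) (good_head cs h₂ rfl)
          with h | h | h
        · exact absurd h n₁
        · exact h
        · exact absurd h n₂

theorem good_swap {D : Subgroup W} (hD : IsDihedralSubgroup cs D) {X Y : List W} {t t' : W}
    (hc : t * t' = t' * t) (hne : t ≠ t') (h : Good cs D (X ++ t :: t' :: Y))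
    (h' : Good cs D (X ++ t' :: t :: Y)) : X = [] ∧ Y = [] := by
  have hX : X = [] := by
    cases X with
    | nil => rfl
    | cons x X =>
      have := good_unique cs hD h _ h' (by simp) (by simp)
      simp at this
      exact absurd this.1 hne
  subst hX
  refine ⟨rfl, ?_⟩
  clear h'
  have htt : MulAut.conj t t' = t' := by
    rw [MulAut.conj_apply, hc]; group
  have htt' : MulAut.conj t' t = t := by
    rw [MulAut.conj_apply, ← hc]; group
  rw [List.nil_append] at h
  cases h with
  | cons _ _ ht hn hg =>
  rw [List.map_cons, htt] at hg
  cases hg with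
  | cons _ _ ht' hn' hg' =>
  cases Y with
  | nil => rfl
  | cons y Y =>
    exfalso
    have hy := good_head cs hg' rfl
    rcases chi_dihedral cs hD ht ht' hy with h | h | h
    · exact hne h
    · have := conj_eq_self h.symm
      apply hn'
      simp only [List.map_cons, List.mem_cons]
      exact Or.inl this.symm
    · have h2 : MulAut.conj t' t = MulAut.conj t' (MulAut.conj t y) := by rw [htt']; exact h
      have := conj_eq_self ((MulAut.conj t').injective h2).symm
      apply hn
      simp [this]

end Dihedral

section Words

variable {B : Type*} {W : Type*} [Group W] {M : CoxeterMatrix B} (cs : CoxeterSystem M W)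

theorem commMove_symm {ω ω' : List B} (h : CommMove cs ω ω') : CommMove cs ω' ω := by
  obtain ⟨l, r, i, j, hc, rfl, rfl⟩ := h
  exact ⟨l, r, j, i, hc.symm, rfl, rfl⟩

theorem commMove_cons (k : B) {ω ω' : List B} (h : CommMove cs ω ω') :
    CommMove cs (k :: ω) (k :: ω') := by
  obtain ⟨l, r, i, j, hc, rfl, rfl⟩ := h
  exact ⟨k :: l, r, i, j, hc, rfl, rfl⟩

theorem commMove_reduced {ω ω' : List B} (h : CommMove cs ω ω') (hω : cs.IsReduced ω) :
    cs.IsReduced ω' ∧ cs.wordProd ω' = cs.wordProd ω := by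
  obtain ⟨l, r, i, j, hc, rfl, rfl⟩ := h
  have e : cs.wordProd (l ++ j :: i :: r) = cs.wordProd (l ++ i :: j :: r) := by
    simp only [cs.wordProd_append, cs.wordProd_cons]
    rw [← mul_assoc (cs.simple i), hc, mul_assoc]
  refine ⟨?_, e⟩
  have := hω.eq
  unfold CoxeterSystem.IsReduced
  rw [e, this]
  simp

theorem lis_swap {ω ω' : List B} (h : CommMove cs ω ω') : ∃ X Y t t', t * t' = t' * t ∧
    cs.leftInvSeq ω = X ++ t :: t' :: Y ∧ cs.leftInvSeq ω' = X ++ t' :: t :: Y := by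
  obtain ⟨l, r, i, j, hc, rfl, rfl⟩ := h
  have hij : MulAut.conj (cs.simple i) (cs.simple j) = cs.simple j := by
    rw [MulAut.conj_apply, hc]; group
  have hji : MulAut.conj (cs.simple j) (cs.simple i) = cs.simple i := by
    rw [MulAut.conj_apply, ← hc]; group
  refine ⟨cs.leftInvSeq l, ((cs.leftInvSeq r).map (MulAut.conj (cs.simple i * cs.simple j))).map
    (MulAut.conj (cs.wordProd l)), MulAut.conj (cs.wordProd l) (cs.simple i),
    MulAut.conj (cs.wordProd l) (cs.simple j), ?_, ?_, ?_⟩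
  · rw [← map_mul, hc, map_mul]
  · rw [lis_append]
    simp only [CoxeterSystem.leftInvSeq, List.map_cons, List.map_map, hij]
    simp
  · rw [lis_append]
    simp only [CoxeterSystem.leftInvSeq, List.map_cons, List.map_map, hji]
    simp [hc]

theorem filter_swap {α : Type*} (p : α → Bool) (X Y : List α) (t t' : α) (h : ¬ (p t ∧ p t')) :
    (X ++ t :: t' :: Y).filter p = (X ++ t' :: t :: Y).filter p := by
  simp only [List.filter_append, List.filter_cons]
  by_cases h1 : p t <;> by_cases h2 : p t' <;> simp_all

/-- Non-commuting pairs occur in the same order. -/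
def Agree (L L' : List W) : Prop :=
  ∀ t t' : W, t * t' ≠ t' * t → List.Sublist [t, t'] L → List.Sublist [t, t'] L'

theorem agree_commMove {ω ω' : List B} (h : CommMove cs ω ω') :
    Agree (cs.leftInvSeq ω) (cs.leftInvSeq ω') := by
  classical
  obtain ⟨X, Y, t, t', hc, e, e'⟩ := lis_swap cs h
  intro a b hab hs
  rw [e] at hs
  rw [e']
  by_cases hh : (t = a ∨ t = b) ∧ (t' = a ∨ t' = b)
  · rcases hh with ⟨rfl | rfl, rfl | rfl⟩
    · exact hs
    · exact absurd hc hab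
    · exact absurd hc.symm hab
    · exact hs
  · have h1 := filter_swap (fun x => decide (x = a ∨ x = b)) X Y t t' (by simpa using hh)
    have h2 := hs.filter (fun x => decide (x = a ∨ x = b))
    rw [h1] at h2
    refine List.Sublist.trans ?_ (h2.trans List.filter_sublist)
    simp

theorem mem_commMove {ω ω' : List B} (h : CommMove cs ω ω') (x : W) :
    x ∈ cs.leftInvSeq ω ↔ x ∈ cs.leftInvSeq ω' := by
  obtain ⟨X, Y, t, t', hc, e, e'⟩ := lis_swap cs h
  rw [e, e']
  simp only [List.mem_append, List.mem_cons]
  tauto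

theorem front {ω : List B} {t : W} {X Y : List W} (h : cs.leftInvSeq ω = X ++ t :: Y)
    (hX : ∀ x ∈ X, x * t = t * x) :
    ∃ k v, Relation.ReflTransGen (CommMove cs) ω (k :: v) ∧ cs.simple k = t := by
  induction ω generalizing X Y with
  | nil => simp at h
  | cons a u ih =>
    cases X with
    | nil =>
      simp only [CoxeterSystem.leftInvSeq, List.nil_append, List.cons.injEq] at h
      exact ⟨a, u, Relation.ReflTransGen.refl, h.1⟩
    | cons x X =>
      simp only [CoxeterSystem.leftInvSeq, List.cons_append, List.cons.injEq] at h
      obtain ⟨rfl, h⟩ := h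
      have hat := hX (cs.simple a) (by simp)
      have hconj : MulAut.conj (cs.simple a) t = t := by
        rw [MulAut.conj_apply, hat]; group
      rw [List.map_eq_append_iff] at h
      obtain ⟨X', Z, hu, hX', hZ⟩ := h
      rw [List.map_eq_cons_iff] at hZ
      obtain ⟨t1, Y', rfl, ht1, hY'⟩ := hZ
      have : t1 = t := (MulAut.conj (cs.simple a)).injective (ht1.trans hconj.symm)
      subst this
      obtain ⟨k, v, hkv, hk⟩ := ih hu (by
        intro x hx
        apply (MulAut.conj (cs.simple a)).injective
        rw [map_mul, map_mul, hconj]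
        apply hX
        rw [← hX']
        exact List.mem_cons_of_mem _ (List.mem_map_of_mem hx))
      refine ⟨k, a :: v, ?_, hk⟩
      have h1 : Relation.ReflTransGen (CommMove cs) (a :: u) (a :: k :: v) :=
        Relation.ReflTransGen.lift (List.cons a) (fun _ _ h => commMove_cons cs a h) _ _ hkv
      exact h1.tail ⟨[], v, a, k, by rw [hk]; exact hat, rfl, rfl⟩

theorem rtg_props {ω ω' : List B} (h : Relation.ReflTransGen (CommMove cs) ω ω')
    (hω : cs.IsReduced ω) : cs.IsReduced ω' ∧ cs.wordProd ω' = cs.wordProd ω ∧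
      Agree (cs.leftInvSeq ω') (cs.leftInvSeq ω) ∧
      ∀ x, x ∈ cs.leftInvSeq ω ↔ x ∈ cs.leftInvSeq ω' := by
  induction h with
  | refl => exact ⟨hω, rfl, fun _ _ _ h => h, fun _ => Iff.rfl⟩
  | tail _ hbc ih =>
    obtain ⟨h1, h2, h3, h4⟩ := ih
    obtain ⟨h5, h6⟩ := commMove_reduced cs hbc h1
    exact ⟨h5, h6.trans h2,
      fun a b hab hs => h3 a b hab (agree_commMove cs (commMove_symm cs hbc) a b hab hs),
      fun x => (h4 x).trans (mem_commMove cs hbc x)⟩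

theorem conj_conj_map (i : B) (L : List W) :
    (L.map (MulAut.conj (cs.simple i))).map (MulAut.conj (cs.simple i)) = L := by
  rw [List.map_map]
  have : (⇑(MulAut.conj (cs.simple i)) ∘ ⇑(MulAut.conj (cs.simple i))) = id := by
    ext x; simp [mul_assoc]
  rw [this, List.map_id]

theorem comm_of_agree (ω' : List B) : ∀ ω : List B, cs.IsReduced ω → cs.IsReduced ω' →
    (∀ x, x ∈ cs.leftInvSeq ω ↔ x ∈ cs.leftInvSeq ω') →
    Agree (cs.leftInvSeq ω) (cs.leftInvSeq ω') →
    ∃ ω'', Relation.ReflTransGen (CommMove cs) ω ω'' ∧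
      ω''.map cs.simple = ω'.map cs.simple := by
  induction ω' with
  | nil =>
    intro ω _ _ hm _
    refine ⟨ω, Relation.ReflTransGen.refl, ?_⟩
    cases ω with
    | nil => rfl
    | cons a u => simp [CoxeterSystem.leftInvSeq] at hm; exact absurd rfl (hm (cs.simple a)).1
  | cons i u ih =>
    intro ω hω hω' hm hag
    have hnd' := hω'.nodup_leftInvSeq
    have hu : cs.IsReduced u := by simpa using hω'.drop 1
    have hmem : cs.simple i ∈ cs.leftInvSeq ω := by
      rw [hm]; simp [CoxeterSystem.leftInvSeq]
    obtain ⟨X, Y, hXY⟩ := List.append_of_mem hmem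
    obtain ⟨k, v, hkv, hk⟩ := front cs hXY (by
      intro x hx
      by_contra hne
      have h1 : List.Sublist [x, cs.simple i] (cs.leftInvSeq ω) := by
        rw [hXY]
        exact List.Sublist.append (List.singleton_sublist.2 hx)
          (List.singleton_sublist.2 (by simp) : List.Sublist [cs.simple i] (cs.simple i :: Y))
      have h2 := hag _ _ hne h1
      simp only [CoxeterSystem.leftInvSeq, List.nodup_cons] at hnd' h2
      cases h2 with
      | cons _ h2 => exact hnd'.1 (h2.subset (by simp))
      | cons_cons _ h2 => exact hnd'.1 (h2.subset (by simp)))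
    obtain ⟨hr, -, hag2, hm2⟩ := rtg_props cs hkv hω
    have hnd := hr.nodup_leftInvSeq
    have hv : cs.IsReduced v := by simpa using hr.drop 1
    have hag3 : Agree (cs.leftInvSeq (k :: v)) (cs.leftInvSeq (i :: u)) :=
      fun a b hab hs => hag a b hab (hag2 a b hab hs)
    have hm3 : ∀ x, x ∈ cs.leftInvSeq (k :: v) ↔ x ∈ cs.leftInvSeq (i :: u) :=
      fun x => (hm2 x).symm.trans (hm x)
    simp only [CoxeterSystem.leftInvSeq, List.nodup_cons, hk] at hnd hnd' hag3 hm3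
    obtain ⟨u'', h1, h2⟩ := ih v hv hu (by
      intro x
      have hm4 : ∀ y, y ∈ (cs.leftInvSeq v).map (MulAut.conj (cs.simple i)) ↔
          y ∈ (cs.leftInvSeq u).map (MulAut.conj (cs.simple i)) := by
        intro y
        by_cases hy : y = cs.simple i
        · subst hy
          exact iff_of_false hnd.1 hnd'.1
        · have := hm3 y
          simpa only [List.mem_cons, hy, false_or] using this
      have := hm4 (MulAut.conj (cs.simple i) x)
      rwa [List.mem_map_of_injective (MulAut.conj (cs.simple i)).injective,
        List.mem_map_of_injective (MulAut.conj (cs.simple i)).injective] at this) (by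
      intro a b hab hs
      have hs1 := hs.map (MulAut.conj (cs.simple i))
      have hab' : MulAut.conj (cs.simple i) a * MulAut.conj (cs.simple i) b ≠
          MulAut.conj (cs.simple i) b * MulAut.conj (cs.simple i) a := by
        rw [← map_mul, ← map_mul]
        exact fun h => hab ((MulAut.conj (cs.simple i)).injective h)
      have hs2 := hag3 _ _ hab' (hs1.trans (List.sublist_cons_self _ _))
      have hs3 : List.Sublist [MulAut.conj (cs.simple i) a, MulAut.conj (cs.simple i) b]
          ((cs.leftInvSeq u).map (MulAut.conj (cs.simple i))) := by
        generalize hx : MulAut.conj (cs.simple i) a = x at hs2 hs1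
        cases hs2 with
        | cons _ h => exact h
        | cons_cons _ h =>
          exfalso
          apply hnd.1
          have h5 : MulAut.conj (cs.simple i) a ∈
              (cs.leftInvSeq v).map (MulAut.conj (cs.simple i)) := hs1.subset (by simp)
          rwa [hx] at h5
      have hs4 := hs3.map (MulAut.conj (cs.simple i))
      rw [conj_conj_map] at hs4
      have := conj_conj_map cs i [a, b]
      simp only [List.map_cons, List.map_nil] at this hs4
      rwa [this] at hs4)
    have h3 : Relation.ReflTransGen (CommMove cs) (k :: v) (k :: u'') :=
      Relation.ReflTransGen.lift (List.cons k) (fun _ _ h => commMove_cons cs k h) _ _ h1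
    refine ⟨k :: u'', hkv.trans h3, ?_⟩
    simp [hk, h2]

end Words

section Poly

variable {α : Type*} {r : α → α → Prop}

theorem polygon_of_four (hrefl : ∀ x, r x x) (hanti : ∀ x y, r x y → r y x → x = y)
    (htrans : ∀ x y z, r x y → r y z → r x z)
    {x y a b : α} (hI : IccR r x y = {x, a, b, y}) (hab : ¬ r a b) (hba : ¬ r b a) :
    IsPolygonPair r x y {x, a, y} {x, b, y} ∧ (IccR r x y).ncard = 4 := by
  have ha : a ∈ IccR r x y := by rw [hI]; simp
  have hb : b ∈ IccR r x y := by rw [hI]; simp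
  have hxy : r x y := htrans _ _ _ ha.1 ha.2
  have xI : x ∈ IccR r x y := ⟨hrefl _, hxy⟩
  have yI : y ∈ IccR r x y := ⟨hxy, hrefl _⟩
  have hxa : x ≠ a := by rintro rfl; exact hab hb.1
  have hxb : x ≠ b := by rintro rfl; exact hba ha.1
  have hay : a ≠ y := by rintro rfl; exact hba hb.2
  have hby : b ≠ y := by rintro rfl; exact hab ha.2
  have hne : x ≠ y := by rintro rfl; exact hxa (hanti _ _ ha.1 ha.2)
  have hab' : a ≠ b := by rintro rfl; exact hab (hrefl _)
  have chain : ∀ c ∈ IccR r x y, IsChain r {x, c, y} := by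
    intro c hc p hp q hq hpq
    simp only [Set.mem_insert_iff, Set.mem_singleton_iff] at hp hq
    rcases hp with rfl | rfl | rfl <;> rcases hq with rfl | rfl | rfl
    · exact absurd rfl hpq
    · exact Or.inl hc.1
    · exact Or.inl hxy
    · exact Or.inr hc.1
    · exact absurd rfl hpq
    · exact Or.inl hc.2
    · exact Or.inr hxy
    · exact Or.inr hc.2
    · exact absurd rfl hpq
  have maxi : ∀ C : Set α, C ⊆ IccR r x y → IsChain r C → C ⊆ {x, a, y} ∨ C ⊆ {x, b, y} := by
    intro C hC hCc
    by_cases haC : a ∈ C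
    · left
      intro z hz
      have := hC hz
      rw [hI] at this
      simp only [Set.mem_insert_iff, Set.mem_singleton_iff] at this ⊢
      rcases this with h | h | h | h
      · exact Or.inl h
      · exact Or.inr (Or.inl h)
      · subst h
        rcases hCc haC hz hab' with h | h
        · exact absurd h hab
        · exact absurd h hba
      · exact Or.inr (Or.inr h)
    · right
      intro z hz
      have := hC hz
      rw [hI] at this
      simp only [Set.mem_insert_iff, Set.mem_singleton_iff] at this ⊢
      rcases this with h | h | h | h
      · exact Or.inl h
      · subst h; exact absurd hz haC
      · exact Or.inr (Or.inl h)
      · exact Or.inr (Or.inr h)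
  have sub : ∀ c ∈ IccR r x y, ({x, c, y} : Set α) ⊆ IccR r x y := by
    intro c hc z hz
    simp only [Set.mem_insert_iff, Set.mem_singleton_iff] at hz
    rcases hz with rfl | rfl | rfl <;> assumption
  refine ⟨⟨hxy, ⟨sub a ha, chain a ha, ?_⟩, ⟨sub b hb, chain b hb, ?_⟩, ?_, ?_, ?_, ?_⟩, ?_⟩
  · intro C hC hCc hs
    rcases maxi C hC hCc with h | h
    · exact Set.Subset.antisymm hs h
    · exfalso
      have := h (hs (by simp : a ∈ _))
      simp [hxa.symm, hab', hay] at this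
  · intro C hC hCc hs
    rcases maxi C hC hCc with h | h
    · exfalso
      have := h (hs (by simp : b ∈ _))
      simp [hxb.symm, hab'.symm, hby] at this
    · exact Set.Subset.antisymm hs h
  · intro h
    have : a ∈ ({x, b, y} : Set α) := by rw [← h]; simp
    simp [hxa.symm, hab', hay] at this
  · rw [hI]; ext z; simp; tauto
  · ext z
    simp only [Set.mem_inter_iff, Set.mem_insert_iff, Set.mem_singleton_iff]
    constructor
    · rintro ⟨h1, h2⟩
      rcases h1 with h | h | h
      · exact Or.inl h
      · subst h
        rcases h2 with h | h | h
        · exact Or.inl h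
        · exact absurd h hab'
        · exact Or.inr h
      · exact Or.inr h
    · tauto
  · intro C hC
    rcases maxi C hC.1 hC.2.1 with h | h
    · exact Or.inl (hC.2.2 _ (sub a ha) (chain a ha) h)
    · exact Or.inr (hC.2.2 _ (sub b hb) (chain b hb) h)
  · rw [hI, Set.ncard_insert_of_notMem (by simp [hxa, hxb, hne]),
      Set.ncard_insert_of_notMem (by simp [hab', hay]), Set.ncard_pair hby]

theorem four_of_polygon (hrefl : ∀ x, r x x) (hanti : ∀ x y, r x y → r y x → x = y)
    {x y : α} {P₁ P₂ : Set α}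
    (hP : IsPolygonPair r x y P₁ P₂) (hc : (IccR r x y).ncard = 4) :
    ∃ a b, P₁ = {x, a, y} ∧ P₂ = {x, b, y} ∧ IccR r x y = {x, a, b, y} ∧ ¬ r a b ∧ ¬ r b a := by
  obtain ⟨hxy, ⟨s1, c1, m1⟩, ⟨s2, c2, m2⟩, hne, hU, hI, -⟩ := hP
  have x12 : x ∈ P₁ ∩ P₂ := by rw [hI]; simp
  have y12 : y ∈ P₁ ∩ P₂ := by rw [hI]; simp
  have hxy' : x ≠ y := by
    rintro rfl
    have : IccR r x x ⊆ {x} := fun z hz => (hanti _ _ hz.1 hz.2).symm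
    have := Set.ncard_le_ncard this
    simp [hc] at this
  have A : ∃ a ∈ P₁, a ≠ x ∧ a ≠ y := by
    by_contra! h
    apply hne
    apply m1 _ s2 c2
    intro z hz
    by_cases hzx : z = x
    · exact hzx ▸ x12.2
    · exact h z hz hzx ▸ y12.2
  have B : ∃ b ∈ P₂, b ≠ x ∧ b ≠ y := by
    by_contra! h
    apply hne
    symm
    apply m2 _ s1 c1
    intro z hz
    by_cases hzx : z = x
    · exact hzx ▸ x12.1
    · exact h z hz hzx ▸ y12.1
  obtain ⟨a, ha, hax, hay⟩ := A
  obtain ⟨b, hb, hbx, hby⟩ := B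
  have ha2 : a ∉ P₂ := by
    intro h
    have : a ∈ P₁ ∩ P₂ := ⟨ha, h⟩
    rw [hI] at this
    simp [hax, hay] at this
  have hb1 : b ∉ P₁ := by
    intro h
    have : b ∈ P₁ ∩ P₂ := ⟨h, hb⟩
    rw [hI] at this
    simp [hbx, hby] at this
  have hab : a ≠ b := by rintro rfl; exact ha2 hb
  have hfour : ({x, a, b, y} : Set α).ncard = 4 := by
    rw [Set.ncard_insert_of_notMem (by simp [hax.symm, hbx.symm, hxy']),
      Set.ncard_insert_of_notMem (by simp [hab, hay]), Set.ncard_pair hby]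
  have hfin : (IccR r x y).Finite := Set.finite_of_ncard_ne_zero (by omega)
  have hsub : ({x, a, b, y} : Set α) ⊆ IccR r x y := by
    intro z hz
    simp only [Set.mem_insert_iff, Set.mem_singleton_iff] at hz
    rcases hz with rfl | rfl | rfl | rfl
    · exact s1 x12.1
    · exact s1 ha
    · exact s2 hb
    · exact s1 y12.1
  have hIcc : IccR r x y = {x, a, b, y} :=
    (Set.eq_of_subset_of_ncard_le hsub (by omega) hfin).symm
  have e1 : P₁ = {x, a, y} := by
    ext z
    constructor
    · intro hz
      have := s1 hz
      rw [hIcc] at this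
      simp only [Set.mem_insert_iff, Set.mem_singleton_iff] at this ⊢
      rcases this with h | h | h | h
      · exact Or.inl h
      · exact Or.inr (Or.inl h)
      · exact absurd (h ▸ hz) hb1
      · exact Or.inr (Or.inr h)
    · simp only [Set.mem_insert_iff, Set.mem_singleton_iff]
      rintro (rfl | rfl | rfl)
      exacts [x12.1, ha, y12.1]
  have e2 : P₂ = {x, b, y} := by
    ext z
    constructor
    · intro hz
      have := s2 hz
      rw [hIcc] at this
      simp only [Set.mem_insert_iff, Set.mem_singleton_iff] at this ⊢
      rcases this with h | h | h | h
      · exact Or.inl h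
      · exact absurd (h ▸ hz) ha2
      · exact Or.inr (Or.inl h)
      · exact Or.inr (Or.inr h)
    · simp only [Set.mem_insert_iff, Set.mem_singleton_iff]
      rintro (rfl | rfl | rfl)
      exacts [x12.2, hb, y12.2]
  have hcmp : ¬ (r a b ∨ r b a) := by
    intro hcmp
    have hch : IsChain r (insert b P₁) := by
      apply c1.insert
      intro z hz _
      rw [e1] at hz
      simp only [Set.mem_insert_iff, Set.mem_singleton_iff] at hz
      rcases hz with rfl | rfl | rfl
      · exact Or.inr (s2 hb).1
      · exact hcmp.symm
      · exact Or.inl (s2 hb).2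
    have := m1 _ (Set.insert_subset (s2 hb) s1) hch (Set.subset_insert _ _)
    exact hb1 (this ▸ Set.mem_insert _ _)
  exact ⟨a, b, e1, e2, hIcc, fun h => hcmp (Or.inl h), fun h => hcmp (Or.inr h)⟩

end Poly

section Weak

variable {B : Type*} {W : Type*} [Group W] {M : CoxeterMatrix B} (cs : CoxeterSystem M W)

theorem wk_refl (x : W) : weakLE cs x x := by simp [weakLE]

theorem wk_len {x y : W} (h : weakLE cs x y) : cs.length x ≤ cs.length y := by
  unfold weakLE at h; omega

theorem wk_eq {x y : W} (h : weakLE cs x y) (hl : cs.length y ≤ cs.length x) : x = y := by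
  unfold weakLE at h
  have : cs.length (x⁻¹ * y) = 0 := by omega
  rw [cs.length_eq_zero_iff] at this
  exact (inv_mul_eq_one.1 this)

theorem wk_anti (x y : W) (h : weakLE cs x y) (h' : weakLE cs y x) : x = y :=
  wk_eq cs h (wk_len cs h')

theorem wk_trans (x y z : W) (h : weakLE cs x y) (h' : weakLE cs y z) : weakLE cs x z := by
  unfold weakLE at *
  have h1 := cs.length_mul_le (x⁻¹ * y) (y⁻¹ * z)
  have h2 := cs.length_mul_le x (x⁻¹ * z)
  have e1 : x⁻¹ * y * (y⁻¹ * z) = x⁻¹ * z := by group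
  have e2 : x * (x⁻¹ * z) = z := by group
  rw [e1] at h1
  rw [e2] at h2
  omega

theorem wk_one (x : W) : weakLE cs 1 x := by simp [weakLE]

theorem wk_simple {x : W} {i : B} (h : cs.length (x * cs.simple i) = cs.length x + 1) :
    weakLE cs x (x * cs.simple i) := by
  simp [weakLE, h]

theorem wk_succ {x y : W} (h : weakLE cs x y) (hl : cs.length y = cs.length x + 1) :
    ∃ i, y = x * cs.simple i := by
  unfold weakLE at h
  have : cs.length (x⁻¹ * y) = 1 := by omega
  rw [cs.length_eq_one_iff] at this
  obtain ⟨i, hi⟩ := this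
  exact ⟨i, by rw [← hi]; group⟩

theorem wk_step {x y : W} (h : weakLE cs x y) (hne : x ≠ y) :
    ∃ i, cs.length (x * cs.simple i) = cs.length x + 1 ∧ weakLE cs (x * cs.simple i) y := by
  have hne' : x⁻¹ * y ≠ 1 := fun e => hne (inv_mul_eq_one.1 e)
  obtain ⟨i, hi⟩ := cs.exists_leftDescent_of_ne_one hne'
  rw [cs.isLeftDescent_iff] at hi
  have e : (x * cs.simple i)⁻¹ * y = cs.simple i * (x⁻¹ * y) := by
    rw [mul_inv_rev, cs.inv_simple, mul_assoc]
  have h2 := cs.length_mul_le (x * cs.simple i) ((x * cs.simple i)⁻¹ * y)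
  rw [mul_inv_cancel_left, e] at h2
  have h3 := cs.length_mul_simple x i
  unfold weakLE at h ⊢
  refine ⟨i, ?_⟩
  rw [e]
  refine ⟨?_, ?_⟩ <;> omega

theorem refl_inv_long {w₀ : W} (hw₀ : ∀ w : W, cs.length w ≤ cs.length w₀) {t : W}
    (ht : cs.IsReflection t) : cs.IsLeftInversion w₀ t :=
  ⟨ht, lt_of_le_of_ne (hw₀ _) (ht.length_mul_right_ne w₀)⟩

theorem mem_lis_long {w₀ : W} (hw₀ : ∀ w : W, cs.length w ≤ cs.length w₀) {ω : List B}
    (hω : cs.wordProd ω = w₀) (t : W) : t ∈ cs.leftInvSeq ω ↔ cs.IsReflection t := by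
  constructor
  · exact cs.isReflection_of_mem_leftInvSeq ω
  · intro ht
    apply strong_exchange
    rw [hω]
    exact refl_inv_long cs hw₀ ht

theorem wk_long {w₀ : W} (hw₀ : ∀ w : W, cs.length w ≤ cs.length w₀) (w : W) :
    weakLE cs w w₀ := by
  induction hn : cs.length w generalizing w with
  | zero =>
    rw [cs.length_eq_zero_iff] at hn
    subst hn
    exact wk_one cs _
  | succ n ih =>
    have hne : w ≠ 1 := by rintro rfl; simp at hn
    obtain ⟨i, hi⟩ := cs.exists_rightDescent_of_ne_one hne
    rw [cs.isRightDescent_iff] at hi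
    obtain ⟨v, rfl⟩ : ∃ v, w = v * cs.simple i := ⟨w * cs.simple i, by simp⟩
    rw [cs.simple_mul_simple_cancel_right] at hi
    have hv := ih v (by omega)
    have ht : cs.IsReflection (v * cs.simple i * v⁻¹) := (cs.isReflection_simple i).conj v
    have h1 := refl_inv_long cs hw₀ ht
    have e : w₀ = v * (v⁻¹ * w₀) := by group
    rw [e] at h1
    rcases inv_subadd cs h1 with h2 | h2
    · have := h2.2
      rw [inv_mul_cancel_right] at this
      omega
    · have e2 : v⁻¹ * (v * cs.simple i * v⁻¹) * v = cs.simple i := by group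
      rw [e2, cs.isLeftInversion_simple_iff_isLeftDescent, cs.isLeftDescent_iff] at h2
      unfold weakLE at hv ⊢
      rw [mul_inv_rev, cs.inv_simple, mul_assoc]
      omega

theorem two_step {i j k m : B} (hl : cs.length (cs.simple i * cs.simple j) = 2)
    (h : cs.simple k * cs.simple m = cs.simple i * cs.simple j) :
    cs.simple k = cs.simple i ∨ cs.simple k = cs.simple i * cs.simple j * cs.simple i := by
  have h1 : cs.IsLeftInversion (cs.wordProd [i, j]) (cs.simple k) := by
    rw [cs.isLeftInversion_simple_iff_isLeftDescent]
    unfold CoxeterSystem.IsLeftDescent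
    simp only [cs.wordProd_cons, cs.wordProd_nil, mul_one, hl]
    rw [← h]
    simp
  have := strong_exchange cs h1
  simpa [CoxeterSystem.leftInvSeq] using this

/-- The prefixes of a word. -/
def Pre (ω : List B) : Set W := {x | ∃ j ≤ ω.length, x = cs.wordProd (ω.take j)}

theorem pre_congr {ω ω' : List B} (h : ω.map cs.simple = ω'.map cs.simple) :
    Pre cs ω = Pre cs ω' := by
  have hl : ω.length = ω'.length := by simpa using congrArg List.length h
  have : ∀ j, cs.wordProd (ω.take j) = cs.wordProd (ω'.take j) := by
    intro j
    unfold CoxeterSystem.wordProd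
    rw [List.map_take, List.map_take, h]
  unfold Pre
  simp only [this, hl]

theorem len_take {ω : List B} (hω : cs.IsReduced ω) {j : ℕ} (hj : j ≤ ω.length) :
    cs.length (cs.wordProd (ω.take j)) = j := by
  rw [(hω.take j).eq, List.length_take]; omega

theorem wk_take {ω : List B} (hω : cs.IsReduced ω) {j k : ℕ} (hjk : j ≤ k) (hk : k ≤ ω.length) :
    weakLE cs (cs.wordProd (ω.take j)) (cs.wordProd (ω.take k)) := by
  have e : ω.take k = ω.take j ++ (ω.take k).drop j := by
    conv_lhs => rw [← List.take_append_drop j (ω.take k)]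
    rw [List.take_take, min_eq_left hjk]
  unfold weakLE
  rw [len_take cs hω (hjk.trans hk), len_take cs hω hk]
  conv_lhs => rw [e, cs.wordProd_append, inv_mul_cancel_left]
  rw [((hω.take k).drop j).eq, List.length_drop, List.length_take]
  omega

theorem take_succ_prod (ω : List B) {j : ℕ} (hj : j < ω.length) :
    cs.wordProd (ω.take (j + 1)) = cs.wordProd (ω.take j) * cs.simple ω[j] := by
  rw [List.take_succ_eq_append_getElem hj, cs.wordProd_append]
  simp

theorem cov_take {ω : List B} (hω : cs.IsReduced ω) {j : ℕ} (hj : j < ω.length) :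
    CovR (weakLE cs) (cs.wordProd (ω.take j)) (cs.wordProd (ω.take (j + 1))) := by
  have l1 := len_take cs hω hj.le
  have l2 := len_take cs hω (Nat.succ_le_of_lt hj)
  refine ⟨wk_take cs hω (Nat.le_succ j) hj, ?_, ?_⟩
  · intro h
    rw [h] at l1
    simp at l2
    omega
  · intro z h1 h2
    have := wk_len cs h1
    have := wk_len cs h2
    by_cases h : cs.length z ≤ cs.length (cs.wordProd (ω.take j))
    · exact Or.inl (wk_eq cs h1 h).symm
    · right
      apply wk_eq cs h2
      simp at l2
      omega

theorem cov_pre {ω : List B} (hω : cs.IsReduced ω) {a b : W} (ha : a ∈ Pre cs ω)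
    (hb : b ∈ Pre cs ω) (h : CovR (weakLE cs) a b) :
    ∃ j, j < ω.length ∧ a = cs.wordProd (ω.take j) ∧ b = cs.wordProd (ω.take (j + 1)) := by
  obtain ⟨j, hj, rfl⟩ := ha
  obtain ⟨k, hk, rfl⟩ := hb
  have l1 := len_take cs hω hj
  have l2 := len_take cs hω hk
  have h3 := wk_len cs h.1
  rw [l1, l2] at h3
  have hjk : j ≠ k := by rintro rfl; exact h.2.1 rfl
  refine ⟨j, by omega, rfl, ?_⟩
  rcases h.2.2 (cs.wordProd (ω.take (j + 1))) (wk_take cs hω (Nat.le_succ j) (by omega))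
    (wk_take cs hω (by omega) hk) with h4 | h4
  · have := len_take cs hω (j := j + 1) (by omega)
    rw [h4] at this
    omega
  · exact h4.symm

theorem label_take (ω : List B) {j : ℕ} (hj : j < ω.length) :
    (cs.leftInvSeq ω)[j]? =
      some (cs.wordProd (ω.take (j + 1)) * (cs.wordProd (ω.take j))⁻¹) := by
  rw [List.getElem?_eq_getElem (by simpa using hj), cs.getElem_leftInvSeq ω j hj,
    take_succ_prod cs ω hj]

theorem pair_sublist {α : Type*} (L : List α) (a b : α) :
    (∃ j k : ℕ, j < k ∧ L[j]? = some a ∧ L[k]? = some b) ↔ [a, b].Sublist L := by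
  induction L with
  | nil => simp
  | cons c L ih =>
    constructor
    · rintro ⟨j, k, hjk, h1, h2⟩
      obtain ⟨k, rfl⟩ : ∃ k', k = k' + 1 := ⟨k - 1, by omega⟩
      rw [List.getElem?_cons_succ] at h2
      cases j with
      | zero =>
        simp at h1
        subst h1
        exact List.Sublist.cons_cons _ (List.singleton_sublist.2 (List.mem_of_getElem? h2))
      | succ j =>
        rw [List.getElem?_cons_succ] at h1
        exact List.Sublist.cons _ (ih.1 ⟨j, k, by omega, h1, h2⟩)
    · intro h
      cases h with
      | cons _ h =>
        obtain ⟨j, k, hjk, h1, h2⟩ := ih.2 h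
        exact ⟨j + 1, k + 1, by omega, by simpa using h1, by simpa using h2⟩
      | cons_cons _ h =>
        rw [List.singleton_sublist] at h
        obtain ⟨k, hk⟩ := List.mem_iff_getElem?.1 h
        exact ⟨0, k + 1, by omega, by simp, by simpa using hk⟩

theorem seqBefore_iff (ω : List B) (t t' : W) :
    seqBefore cs ω t t' ↔ [t, t'].Sublist (cs.leftInvSeq ω) := pair_sublist _ _ _

theorem chainBefore_iff {ω : List B} (hω : cs.IsReduced ω) (t t' : W) :
    chainBefore cs (Pre cs ω) t t' ↔ [t, t'].Sublist (cs.leftInvSeq ω) := by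
  rw [← pair_sublist]
  constructor
  · rintro ⟨a, b, c, d, ha, hb, hc, hd, h1, h2, rfl, rfl, h3⟩
    obtain ⟨j, hj, rfl, rfl⟩ := cov_pre cs hω ha hb h1
    obtain ⟨k, hk, rfl, rfl⟩ := cov_pre cs hω hc hd h2
    refine ⟨j, k, ?_, label_take cs ω hj, label_take cs ω hk⟩
    have := wk_len cs h3
    rw [len_take cs hω hj, len_take cs hω hk.le] at this
    omega
  · rintro ⟨j, k, hjk, h1, h2⟩
    have hk : k < ω.length := by
      have := (List.getElem?_eq_some_iff.1 h2).1
      simpa using this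
    have hj : j < ω.length := by omega
    rw [label_take cs ω hj, Option.some_inj] at h1
    rw [label_take cs ω hk, Option.some_inj] at h2
    exact ⟨_, _, _, _, ⟨j, hj.le, rfl⟩, ⟨j + 1, hj, rfl⟩, ⟨k, hk.le, rfl⟩, ⟨k + 1, hk, rfl⟩,
      cov_take cs hω hj, cov_take cs hω hk, h1.symm, h2.symm, wk_take cs hω hjk hk.le⟩

end Weak

section Chains

variable {B : Type*} {W : Type*} [Group W] {M : CoxeterMatrix B} (cs : CoxeterSystem M W)

theorem mem_of_comparable {C : Set W} (hC : IsMaxChain (weakLE cs) C) {x : W}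
    (h : ∀ c ∈ C, weakLE cs x c ∨ weakLE cs c x) : x ∈ C := by
  have := hC.2 (hC.1.insert (a := x) (fun b hb _ => h b hb)) (Set.subset_insert _ _)
  rw [this]
  exact Set.mem_insert _ _

theorem comparable {C : Set W} (hC : IsMaxChain (weakLE cs) C) {x y : W} (hx : x ∈ C)
    (hy : y ∈ C) : weakLE cs x y ∨ weakLE cs y x := by
  by_cases h : x = y
  · subst h; exact Or.inl (wk_refl cs x)
  · exact hC.1 hx hy h

theorem chain_step {w₀ : W} (hw₀ : ∀ w : W, cs.length w ≤ cs.length w₀) {C : Set W}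
    (hC : IsMaxChain (weakLE cs) C) {u : W} (hu : u ∈ C) (hne : u ≠ w₀) :
    ∃ i, cs.length (u * cs.simple i) = cs.length u + 1 ∧ u * cs.simple i ∈ C := by
  have hw : w₀ ∈ C := mem_of_comparable cs hC (fun c _ => Or.inr (wk_long cs hw₀ c))
  obtain ⟨w, ⟨hwC, huw, hnw⟩, hmin⟩ := (measure cs.length).wf.has_min
    {w | w ∈ C ∧ weakLE cs u w ∧ u ≠ w} ⟨w₀, hw, wk_long cs hw₀ u, hne⟩
  obtain ⟨i, hi, hiw⟩ := wk_step cs huw hnw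
  refine ⟨i, hi, mem_of_comparable cs hC ?_⟩
  intro c hc
  rcases comparable cs hC hc hu with h | h
  · exact Or.inr (wk_trans cs _ _ _ h (wk_simple cs hi))
  · by_cases huc : u = c
    · subst huc; exact Or.inr (wk_simple cs hi)
    · left
      have hm : ¬ cs.length c < cs.length w := hmin c ⟨hc, h, huc⟩
      rcases comparable cs hC hwC hc with h1 | h1
      · exact wk_trans cs _ _ _ hiw h1
      · rw [wk_eq cs h1 (by omega)]; exact hiw

theorem pre_concat (ω : List B) (i : B) :
    Pre cs (ω ++ [i]) ⊆ insert (cs.wordProd ω * cs.simple i) (Pre cs ω) := by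
  rintro x ⟨j, hj, rfl⟩
  by_cases h : j ≤ ω.length
  · right
    exact ⟨j, h, by rw [List.take_append_of_le_length h]⟩
  · left
    rw [List.take_of_length_le (by simp; omega), cs.wordProd_append]
    simp

theorem chain_word {w₀ : W} (hw₀ : ∀ w : W, cs.length w ≤ cs.length w₀) {C : Set W}
    (hC : IsMaxChain (weakLE cs) C) :
    ∃ ω, cs.IsReduced ω ∧ cs.wordProd ω = w₀ ∧ C = Pre cs ω := by
  have key : ∀ n ≤ cs.length w₀, ∃ ω : List B, ω.length = n ∧ cs.IsReduced ω ∧ Pre cs ω ⊆ C := by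
    intro n
    induction n with
    | zero =>
      intro _
      refine ⟨[], rfl, by simp [CoxeterSystem.IsReduced], ?_⟩
      rintro x ⟨j, _, rfl⟩
      simp only [List.take_nil, cs.wordProd_nil]
      exact mem_of_comparable cs hC (fun c _ => Or.inl (wk_one cs c))
    | succ n ih =>
      intro hn
      obtain ⟨ω, hl, hr, hp⟩ := ih (by omega)
      have hm : cs.wordProd ω ∈ C := hp ⟨ω.length, le_rfl, by simp⟩
      have hne : cs.wordProd ω ≠ w₀ := by
        intro h
        have := hr.eq
        rw [h] at this
        omega
      obtain ⟨i, hi, hiC⟩ := chain_step cs hw₀ hC hm hne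
      refine ⟨ω ++ [i], by simp [hl], ?_, ?_⟩
      · unfold CoxeterSystem.IsReduced
        rw [cs.wordProd_append]
        simp only [cs.wordProd_cons, cs.wordProd_nil, mul_one, List.length_append,
          List.length_singleton]
        rw [hi, hr.eq]
      · exact (pre_concat cs ω i).trans (Set.insert_subset hiC hp)
  obtain ⟨ω, hl, hr, hp⟩ := key _ le_rfl
  have hl2 : cs.length (cs.wordProd ω) = cs.length w₀ := by rw [hr.eq, hl]
  refine ⟨ω, hr, wk_eq cs (wk_long cs hw₀ _) hl2.ge, Set.Subset.antisymm ?_ hp⟩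
  intro c hc
  have hcl : cs.length c ≤ ω.length := hl ▸ hw₀ c
  have hm : cs.wordProd (ω.take (cs.length c)) ∈ Pre cs ω := ⟨_, hcl, rfl⟩
  have hlen := len_take cs hr hcl
  have : c = cs.wordProd (ω.take (cs.length c)) := by
    rcases comparable cs hC hc (hp hm) with h | h
    · exact wk_eq cs h hlen.le
    · exact (wk_eq cs h hlen.ge).symm
  rw [this]
  exact hm

theorem take_swap (l r : List B) {i j : B}
    (hc : cs.simple i * cs.simple j = cs.simple j * cs.simple i) {k : ℕ} (hk : k ≠ l.length + 1) :
    cs.wordProd ((l ++ i :: j :: r).take k) = cs.wordProd ((l ++ j :: i :: r).take k) := by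
  by_cases h : k ≤ l.length
  · rw [List.take_append_of_le_length h, List.take_append_of_le_length h]
  · obtain ⟨m, rfl⟩ : ∃ m, k = l.length + (m + 2) := ⟨k - l.length - 2, by omega⟩
    rw [List.take_length_add_append, List.take_length_add_append]
    simp only [List.take_succ_cons, cs.wordProd_append, cs.wordProd_cons]
    rw [← mul_assoc (cs.simple i), hc, mul_assoc]

theorem take_l (l r : List B) (i j : B) :
    cs.wordProd ((l ++ i :: j :: r).take l.length) = cs.wordProd l ∧
    cs.wordProd ((l ++ i :: j :: r).take (l.length + 1)) = cs.wordProd l * cs.simple i ∧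
    cs.wordProd ((l ++ i :: j :: r).take (l.length + 2)) =
      cs.wordProd l * cs.simple i * cs.simple j := by
  refine ⟨by simp, ?_, ?_⟩
  · rw [List.take_length_add_append]; simp [cs.wordProd_append, cs.wordProd_cons]
  · rw [List.take_length_add_append]; simp [cs.wordProd_append, cs.wordProd_cons, mul_assoc]

theorem pre_diff (l r : List B) {i j : B}
    (hc : cs.simple i * cs.simple j = cs.simple j * cs.simple i)
    (hω : cs.IsReduced (l ++ i :: j :: r)) :
    Pre cs (l ++ i :: j :: r) \
      {cs.wordProd l, cs.wordProd l * cs.simple i, cs.wordProd l * cs.simple i * cs.simple j} ⊆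
    Pre cs (l ++ j :: i :: r) \
      {cs.wordProd l, cs.wordProd l * cs.simple j, cs.wordProd l * cs.simple i * cs.simple j} := by
  obtain ⟨e0, e1, e2⟩ := take_l cs l r i j
  obtain ⟨f0, f1, f2⟩ := take_l cs l r j i
  have hω' : cs.IsReduced (l ++ j :: i :: r) :=
    (commMove_reduced cs ⟨l, r, i, j, hc, rfl, rfl⟩ hω).1
  rintro z ⟨⟨k, hk, rfl⟩, hz⟩
  simp only [Set.mem_insert_iff, Set.mem_singleton_iff, not_or] at hz
  have h0 : k ≠ l.length := by rintro rfl; exact hz.1 e0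
  have h1 : k ≠ l.length + 1 := by rintro rfl; exact hz.2.1 e1
  have h2 : k ≠ l.length + 2 := by rintro rfl; exact hz.2.2 e2
  have hk' : k ≤ (l ++ j :: i :: r).length := by simpa using hk
  refine ⟨⟨k, hk', take_swap cs l r hc h1⟩, ?_⟩
  simp only [Set.mem_insert_iff, Set.mem_singleton_iff, not_or]
  refine ⟨hz.1, ?_, hz.2.2⟩
  rw [take_swap cs l r hc h1, ← f1]
  intro h
  have := congrArg cs.length h
  rw [len_take cs hω' hk', len_take cs hω' (by simp)] at this
  exact h1 this

theorem pre_diff_eq (l r : List B) {i j : B}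
    (hc : cs.simple i * cs.simple j = cs.simple j * cs.simple i)
    (hω : cs.IsReduced (l ++ i :: j :: r)) :
    Pre cs (l ++ i :: j :: r) \
      {cs.wordProd l, cs.wordProd l * cs.simple i, cs.wordProd l * cs.simple i * cs.simple j} =
    Pre cs (l ++ j :: i :: r) \
      {cs.wordProd l, cs.wordProd l * cs.simple j, cs.wordProd l * cs.simple i * cs.simple j} := by
  apply Set.Subset.antisymm (pre_diff cs l r hc hω)
  have h := pre_diff cs l r hc.symm (commMove_reduced cs ⟨l, r, i, j, hc, rfl, rfl⟩ hω).1
  rw [mul_assoc _ (cs.simple j), ← hc, ← mul_assoc] at h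
  exact h

theorem three_sub (l r : List B) (i j : B) :
    {cs.wordProd l, cs.wordProd l * cs.simple i, cs.wordProd l * cs.simple i * cs.simple j} ⊆
    Pre cs (l ++ i :: j :: r) := by
  obtain ⟨e0, e1, e2⟩ := take_l cs l r i j
  rintro z (rfl | rfl | rfl)
  · exact ⟨_, by simp, e0.symm⟩
  · exact ⟨_, by simp, e1.symm⟩
  · exact ⟨_, by simp, e2.symm⟩

theorem icc_comm {x : W} {i j : B}
    (hc : cs.simple i * cs.simple j = cs.simple j * cs.simple i)
    (hl : cs.length (x * cs.simple i * cs.simple j) = cs.length x + 2) :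
    IccR (weakLE cs) x (x * cs.simple i * cs.simple j) =
      {x, x * cs.simple i, x * cs.simple j, x * cs.simple i * cs.simple j} ∧
    ¬ weakLE cs (x * cs.simple i) (x * cs.simple j) ∧
    ¬ weakLE cs (x * cs.simple j) (x * cs.simple i) := by
  have hy : x * cs.simple i * cs.simple j = x * cs.simple j * cs.simple i := by
    rw [mul_assoc, hc, mul_assoc]
  have h1 : cs.length (x * cs.simple i) = cs.length x + 1 := by
    have a := cs.length_mul_simple x i
    have b := cs.length_mul_simple (x * cs.simple i) j
    omega
  have h2 : cs.length (x * cs.simple j) = cs.length x + 1 := by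
    have a := cs.length_mul_simple x j
    have b := cs.length_mul_simple (x * cs.simple j) i
    rw [← hy] at b
    omega
  have h3 : cs.length (cs.simple i * cs.simple j) = 2 := by
    have a := cs.length_mul_le x (cs.simple i * cs.simple j)
    have b := cs.length_mul_le (cs.simple i) (cs.simple j)
    rw [← mul_assoc, hl] at a
    rw [cs.length_simple, cs.length_simple] at b
    omega
  have hij : x * cs.simple i ≠ x * cs.simple j := by
    intro h
    rw [mul_right_inj] at h
    rw [h] at h3
    simp at h3
  have g1 := wk_simple cs h1
  have g2 := wk_simple cs h2
  have g3 : weakLE cs (x * cs.simple i) (x * cs.simple i * cs.simple j) :=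
    wk_simple cs (by omega)
  have g4 : weakLE cs (x * cs.simple j) (x * cs.simple i * cs.simple j) := by
    rw [hy]; exact wk_simple cs (by rw [← hy]; omega)
  have g5 := wk_trans cs _ _ _ g1 g3
  refine ⟨?_, fun h => hij (wk_eq cs h (by omega)), fun h => hij (wk_eq cs h (by omega)).symm⟩
  ext z
  simp only [Set.mem_insert_iff, Set.mem_singleton_iff]
  constructor
  · rintro ⟨hz1, hz2⟩
    have l1 := wk_len cs hz1
    have l2 := wk_len cs hz2
    by_cases c1 : cs.length z = cs.length x
    · exact Or.inl (wk_eq cs hz1 c1.le).symm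
    by_cases c2 : cs.length z = cs.length x + 2
    · exact Or.inr (Or.inr (Or.inr (wk_eq cs hz2 (by omega))))
    obtain ⟨k, rfl⟩ := wk_succ cs hz1 (by omega)
    obtain ⟨m, hm⟩ := wk_succ cs hz2 (by omega)
    have e : cs.simple k * cs.simple m = cs.simple i * cs.simple j := by
      rw [mul_assoc, mul_assoc, mul_right_inj] at hm
      exact hm.symm
    rcases two_step cs h3 e with h | h
    · right; left; rw [h]
    · right; right; left; rw [h, hc]; simp
  · rintro (rfl | rfl | rfl | rfl)
    · exact ⟨wk_refl cs _, g5⟩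
    · exact ⟨g1, g3⟩
    · exact ⟨g2, g4⟩
    · exact ⟨g5, wk_refl cs _⟩

theorem sqMove_of_commMove {ω ω' : List B} (hω : cs.IsReduced ω) (h : CommMove cs ω ω') :
    SquareMove (weakLE cs) (Pre cs ω) (Pre cs ω') := by
  obtain ⟨l, r, i, j, hc, rfl, rfl⟩ := h
  obtain ⟨e0, e1, e2⟩ := take_l cs l r i j
  have hl : cs.length (cs.wordProd l * cs.simple i * cs.simple j) =
      cs.length (cs.wordProd l) + 2 := by
    rw [← e2, ← e0, len_take cs hω (by simp), len_take cs hω (by simp)]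
  obtain ⟨hI, n1, n2⟩ := icc_comm cs hc hl
  obtain ⟨hP, hcard⟩ := polygon_of_four (wk_refl cs) (wk_anti cs) (wk_trans cs) hI n1 n2
  refine ⟨_, _, _, _, hP, hcard, three_sub cs l r i j, ?_, pre_diff_eq cs l r hc hω⟩
  have := three_sub cs l r j i
  rw [mul_assoc _ (cs.simple j), ← hc, ← mul_assoc] at this
  exact this

theorem commMove_of_sqMove {ω : List B} (hω : cs.IsReduced ω) {D : Set W}
    (h : SquareMove (weakLE cs) (Pre cs ω) D) : ∃ ω', CommMove cs ω ω' ∧ D = Pre cs ω' := by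
  obtain ⟨x, y, P₁, P₂, hP, hcard, hs1, hs2, hd⟩ := h
  obtain ⟨a, b, rfl, rfl, hI, n1, n2⟩ := four_of_polygon (wk_refl cs) (wk_anti cs) hP hcard
  have haI : a ∈ IccR (weakLE cs) x y := by rw [hI]; simp
  have hbI : b ∈ IccR (weakLE cs) x y := by rw [hI]; simp
  have hxa : x ≠ a := by rintro rfl; exact n1 hbI.1
  have hay : a ≠ y := by rintro rfl; exact n2 hbI.2
  have hxb : x ≠ b := by rintro rfl; exact n2 haI.1
  have hby : b ≠ y := by rintro rfl; exact n1 haI.2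
  obtain ⟨j, hj, hx⟩ := hs1 (show x ∈ _ by simp)
  obtain ⟨k, hk, ha⟩ := hs1 (show a ∈ _ by simp)
  obtain ⟨m, hm, hy⟩ := hs1 (show y ∈ _ by simp)
  have lx := len_take cs hω hj
  have la := len_take cs hω hk
  have ly := len_take cs hω hm
  rw [← hx] at lx
  rw [← ha] at la
  rw [← hy] at ly
  have hjk : j < k := by
    have h1 := wk_len cs haI.1
    have h2 : j ≠ k := by rintro rfl; exact hxa (hx.trans ha.symm)
    omega
  have hkm : k < m := by
    have h1 := wk_len cs haI.2
    have h2 : k ≠ m := by rintro rfl; exact hay (ha.trans hy.symm)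
    omega
  have mid : ∀ n, j < n → n < m → n = k := by
    intro n h1 h2
    have hn : cs.wordProd (ω.take n) ∈ IccR (weakLE cs) x y := by
      rw [hx, hy]
      exact ⟨wk_take cs hω h1.le (by omega), wk_take cs hω h2.le hm⟩
    have ln := len_take cs hω (j := n) (by omega)
    rw [hI] at hn
    simp only [Set.mem_insert_iff, Set.mem_singleton_iff] at hn
    rcases hn with h | h | h | h
    · rw [h] at ln; omega
    · rw [h] at ln; omega
    · exfalso
      rcases le_total n k with h3 | h3
      · have := wk_take cs hω h3 hk
        rw [h, ← ha] at this
        exact n2 this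
      · have := wk_take cs hω h3 (by omega)
        rw [h, ← ha] at this
        exact n1 this
    · rw [h] at ln; omega
  have hk1 : k = j + 1 := (mid (j + 1) (by omega) (by omega)).symm
  have hm1 : m = j + 2 := by
    by_contra hne
    have := mid (j + 2) (by omega) (by omega)
    omega
  subst hk1
  subst hm1
  have hj1 : j < ω.length := by omega
  have hj2 : j + 1 < ω.length := by omega
  have hdec : ω = ω.take j ++ ω[j] :: ω[j + 1] :: ω.drop (j + 2) := by
    conv_lhs => rw [← List.take_append_drop j ω, List.drop_eq_getElem_cons hj1,
      List.drop_eq_getElem_cons hj2]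
  generalize hi : ω[j] = i at hdec
  generalize hi' : ω[j + 1] = i' at hdec
  have ea : a = x * cs.simple i := by rw [ha, hx, take_succ_prod cs ω hj1, hi]
  have ey : y = x * cs.simple i * cs.simple i' := by
    rw [← ea, hy, ha, take_succ_prod cs ω hj2, hi']
  have lb : cs.length b = j + 1 := by
    have h1 := wk_len cs hbI.1
    have h2 := wk_len cs hbI.2
    have h3 : cs.length b ≠ j := fun h => hxb (wk_eq cs hbI.1 (by omega))
    have h4 : cs.length b ≠ j + 2 := fun h => hby (wk_eq cs hbI.2 (by omega))
    omega
  obtain ⟨p, hp⟩ := wk_succ cs hbI.1 (by omega)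
  obtain ⟨q, hq⟩ := wk_succ cs hbI.2 (by omega)
  have hpq : cs.simple p * cs.simple q = cs.simple i * cs.simple i' := by
    rw [hp, ey, mul_assoc, mul_assoc, mul_right_inj] at hq
    exact hq.symm
  have hl2 : cs.length (cs.simple i * cs.simple i') = 2 := by
    have a1 := cs.length_mul_le x (cs.simple i * cs.simple i')
    have b1 := cs.length_mul_le (cs.simple i) (cs.simple i')
    rw [← mul_assoc, ← ey] at a1
    rw [cs.length_simple, cs.length_simple] at b1
    omega
  have hip : cs.simple p ≠ cs.simple i := by
    intro h
    rw [h, ← ea] at hp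
    subst hp
    exact n1 (wk_refl cs _)
  have c1 := (two_step cs hl2 hpq).resolve_left hip
  have hqi : cs.simple q = cs.simple i := by
    have : cs.simple q = cs.simple p * (cs.simple i * cs.simple i') := by
      rw [← hpq]; simp
    rw [this, c1]
    simp [mul_assoc]
  rw [hqi] at hpq
  have c2 := (two_step cs (hpq ▸ hl2) hpq.symm).resolve_left hip.symm
  have hcomm : cs.simple p * cs.simple i = cs.simple i * cs.simple p := by
    conv_rhs => rw [c2]
    simp [mul_assoc]
  have hpi' : cs.simple p = cs.simple i' := by
    rw [hcomm, mul_right_inj] at hpq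
    exact hpq
  rw [hpi'] at hcomm hp
  refine ⟨ω.take j ++ i' :: i :: ω.drop (j + 2), ⟨_, _, i, i', hcomm.symm, hdec, rfl⟩, ?_⟩
  have hω2 := hω
  rw [hdec] at hω2
  have hdiff := pre_diff_eq cs _ _ hcomm.symm hω2
  have hsub := three_sub cs (ω.take j) (ω.drop (j + 2)) i' i
  rw [mul_assoc _ (cs.simple i'), hcomm, ← mul_assoc] at hsub
  rw [← hdec, ← hx, ← ey, ← ea, ← hp, hd] at hdiff
  rw [← hx, ← ey, ← hp] at hsub
  rw [← Set.sdiff_union_of_subset hs2, hdiff, Set.sdiff_union_of_subset hsub]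

end Chains

section Final

variable {B : Type*} {W : Type*} [Group W] {M : CoxeterMatrix B} (cs : CoxeterSystem M W)

open Classical in
/-- The part of the inversion sequence lying in `D`. -/
noncomputable def FD (D : Subgroup W) (ω : List B) : List W :=
  (cs.leftInvSeq ω).filter (fun x => decide (x ∈ D))

theorem fd_sublist {D : Subgroup W} (ω : List B) {t t' : W} (ht : t ∈ D) (ht' : t' ∈ D) :
    List.Sublist [t, t'] (cs.leftInvSeq ω) ↔ List.Sublist [t, t'] (FD cs D ω) := by
  classical
  constructor
  · intro h
    have := h.filter (fun x => decide (x ∈ D))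
    simpa [List.filter_cons, ht, ht', FD] using this
  · intro h
    exact h.trans List.filter_sublist

theorem fd_mem {D : Subgroup W} (ω : List B) (t : W) :
    t ∈ FD cs D ω ↔ t ∈ cs.leftInvSeq ω ∧ t ∈ D := by
  classical
  simp [FD]

theorem fd_nodup {D : Subgroup W} {ω : List B} (hω : cs.IsReduced ω) : (FD cs D ω).Nodup := by
  classical
  exact hω.nodup_leftInvSeq.filter _

theorem fd_good (D : Subgroup W) {ω : List B} (hω : cs.IsReduced ω) : Good cs D (FD cs D ω) :=
  good_filter cs hω D

theorem no_both {α : Type*} {L : List α} (hL : L.Nodup) {a b : α} (h : List.Sublist [a, b] L)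
    (h' : List.Sublist [b, a] L) : False := by
  rw [← pair_sublist] at h h'
  obtain ⟨j, k, hjk, h1, h2⟩ := h
  obtain ⟨j', k', hjk', h1', h2'⟩ := h'
  have e1 : j = k' := (List.getElem?_inj (List.getElem?_eq_some_iff.1 h1).1 hL).1 (h1.trans h2'.symm)
  have e2 : k = j' := (List.getElem?_inj (List.getElem?_eq_some_iff.1 h2).1 hL).1 (h2.trans h1'.symm)
  omega

theorem fd_mem_eq {w₀ : W} (hw₀ : ∀ w : W, cs.length w ≤ cs.length w₀) (D : Subgroup W)
    {ω ω' : List B} (hp : cs.wordProd ω = w₀) (hp' : cs.wordProd ω' = w₀) (x : W) :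
    x ∈ FD cs D ω ↔ x ∈ FD cs D ω' := by
  rw [fd_mem, fd_mem, mem_lis_long cs hw₀ hp, mem_lis_long cs hw₀ hp']

theorem fd_len {w₀ : W} (hw₀ : ∀ w : W, cs.length w ≤ cs.length w₀) (D : Subgroup W)
    {ω ω' : List B} (hω : cs.IsReduced ω) (hω' : cs.IsReduced ω')
    (hp : cs.wordProd ω = w₀) (hp' : cs.wordProd ω' = w₀) :
    (FD cs D ω).length = (FD cs D ω').length :=
  ((List.perm_ext_iff_of_nodup (fd_nodup cs hω) (fd_nodup cs hω')).2
    (fd_mem_eq cs hw₀ D hp hp')).length_eq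

theorem inv_iff {w₀ : W} (hw₀ : ∀ w : W, cs.length w ≤ cs.length w₀)
    {ω₀ ω : List B} (hω₀ : cs.IsReduced ω₀) (hω : cs.IsReduced ω)
    (hp₀ : cs.wordProd ω₀ = w₀) (hp : cs.wordProd ω = w₀) (D : Subgroup W) :
    D ∈ invSubgroups cs ω₀ (Pre cs ω) ↔
      IsMaxDihedralSubgroup cs D ∧ IsNonCommutative cs D ∧ FD cs D ω₀ ≠ FD cs D ω := by
  unfold invSubgroups
  simp only [Set.mem_ofPred_eq, seqBefore_iff, chainBefore_iff cs hω]
  refine and_congr_right fun hD => and_congr_right fun _ => ?_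
  constructor
  · rintro ⟨t, t', _, _, htD, htD', h1, h2⟩ he
    rw [fd_sublist cs _ htD htD', he] at h1
    rw [fd_sublist cs _ htD' htD] at h2
    exact no_both (fd_nodup cs hω) h1 h2
  · intro hne
    obtain ⟨p, q, h1, h2⟩ := (good_dichotomy cs hD.1 (fd_good cs D hω₀) (fd_good cs D hω)
      (fd_len cs hw₀ D hω₀ hω hp₀ hp) (fd_mem_eq cs hw₀ D hp₀ hp)).resolve_left hne
    have hpm : p ∈ FD cs D ω₀ := h1.subset (by simp)
    have hqm : q ∈ FD cs D ω₀ := h1.subset (by simp)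
    rw [fd_mem, mem_lis_long cs hw₀ hp₀] at hpm hqm
    exact ⟨p, q, hpm.1, hqm.1, hpm.2, hqm.2, (fd_sublist cs _ hpm.2 hqm.2).2 h1,
      (fd_sublist cs _ hqm.2 hpm.2).2 h2⟩

theorem fd_commMove {w₀ : W} (hw₀ : ∀ w : W, cs.length w ≤ cs.length w₀)
    {ω ω' : List B} (hω : cs.IsReduced ω) (hp : cs.wordProd ω = w₀) (h : CommMove cs ω ω')
    {D : Subgroup W} (hD : IsDihedralSubgroup cs D) (hnc : IsNonCommutative cs D) :
    FD cs D ω = FD cs D ω' := by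
  classical
  have hω' := (commMove_reduced cs h hω).1
  obtain ⟨X, Y, t, t', hc, e1, e2⟩ := lis_swap cs h
  by_cases hb : t ∈ D ∧ t' ∈ D
  · exfalso
    have hne : t ≠ t' := by
      have := hω.nodup_leftInvSeq
      rw [e1] at this
      rintro rfl
      have := (List.nodup_append.1 this).2.1
      simp at this
    have g1 := fd_good cs D hω
    have g2 := fd_good cs D hω'
    have f1 : FD cs D ω = X.filter (fun x => decide (x ∈ D)) ++ t :: t' ::
        Y.filter (fun x => decide (x ∈ D)) := by
      simp [FD, e1, List.filter_cons, hb]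
    have f2 : FD cs D ω' = X.filter (fun x => decide (x ∈ D)) ++ t' :: t ::
        Y.filter (fun x => decide (x ∈ D)) := by
      simp [FD, e2, List.filter_cons, hb]
    rw [f1] at g1
    rw [f2] at g2
    obtain ⟨hX, hY⟩ := good_swap cs hD hc hne g1 g2
    rw [hX, hY] at f1
    obtain ⟨p, q, hpr, hqr, hpD, hqD, hpq⟩ := hnc
    have hpm : p ∈ FD cs D ω := (fd_mem cs ω p).2 ⟨(mem_lis_long cs hw₀ hp p).2 hpr, hpD⟩
    have hqm : q ∈ FD cs D ω := (fd_mem cs ω q).2 ⟨(mem_lis_long cs hw₀ hp q).2 hqr, hqD⟩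
    rw [f1] at hpm hqm
    simp only [List.nil_append, List.mem_cons, List.not_mem_nil, or_false] at hpm hqm
    rcases hpm with rfl | rfl <;> rcases hqm with rfl | rfl
    · exact hpq rfl
    · exact hpq hc
    · exact hpq hc.symm
    · exact hpq rfl
  · unfold FD
    rw [e1, e2]
    exact filter_swap _ X Y t t' (by simpa using hb)

theorem sqEquiv_word {w₀ : W} (hw₀ : ∀ w : W, cs.length w ≤ cs.length w₀)
    {ω : List B} (hω : cs.IsReduced ω) (hp : cs.wordProd ω = w₀) {C : Set W}
    (h : SqEquiv (weakLE cs) (Pre cs ω) C) :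
    ∃ ω', cs.IsReduced ω' ∧ cs.wordProd ω' = w₀ ∧ C = Pre cs ω' ∧
      ∀ D, IsDihedralSubgroup cs D → IsNonCommutative cs D → FD cs D ω = FD cs D ω' := by
  unfold SqEquiv at h
  induction h with
  | refl => exact ⟨ω, hω, hp, rfl, fun _ _ _ => rfl⟩
  | tail _ hbc ih =>
    obtain ⟨ω', hr, hp', rfl, hF⟩ := ih
    obtain ⟨ω'', hcm, rfl⟩ := commMove_of_sqMove cs hr hbc
    obtain ⟨hr2, hp2⟩ := commMove_reduced cs hcm hr
    exact ⟨ω'', hr2, hp2.trans hp', rfl, fun D hD hnc =>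
      (hF D hD hnc).trans (fd_commMove cs hw₀ hr hp' hcm hD hnc)⟩

theorem rtg_sqEquiv {ω ω' : List B} (hω : cs.IsReduced ω)
    (h : Relation.ReflTransGen (CommMove cs) ω ω') :
    SqEquiv (weakLE cs) (Pre cs ω) (Pre cs ω') := by
  induction h with
  | refl => exact Relation.ReflTransGen.refl
  | tail hab hbc ih =>
    exact Relation.ReflTransGen.tail ih (sqMove_of_commMove cs (rtg_props cs hab hω).1 hbc)

theorem exists_max [Finite W] {t t' : W} (ht : cs.IsReflection t) (ht' : cs.IsReflection t') :
    ∃ D, IsMaxDihedralSubgroup cs D ∧ t ∈ D ∧ t' ∈ D := by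
  have hfin : {D | IsDihedralSubgroup cs D}.Finite := Set.toFinite _
  obtain ⟨D, hle, hD⟩ := hfin.exists_le_maximal
    (show Subgroup.closure {t, t'} ∈ {D | IsDihedralSubgroup cs D} from ⟨t, t', ht, ht', rfl⟩)
  refine ⟨D, ⟨hD.1, fun D' hD' h => le_antisymm h (hD.2 hD' h)⟩, ?_, ?_⟩
  · exact hle (Subgroup.subset_closure (by simp))
  · exact hle (Subgroup.subset_closure (by simp))

theorem main_thm [Finite W]
    (w₀ : W) (hw₀ : ∀ w : W, cs.length w ≤ cs.length w₀)
    (ω₀ : List B) (hω₀ : cs.IsReduced ω₀) (hω₀p : cs.wordProd ω₀ = w₀)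
    (C C' : Set W)
    (hC : IsMaxChain (weakLE cs) C) (hC' : IsMaxChain (weakLE cs) C') :
    invSubgroups cs ω₀ C = invSubgroups cs ω₀ C' ↔
      SqEquiv (weakLE cs) C C' := by
  obtain ⟨ω, hω, hp, rfl⟩ := chain_word cs hw₀ hC
  constructor
  · intro hinv
    obtain ⟨ω', hω', hp', rfl⟩ := chain_word cs hw₀ hC'
    have hag : Agree (cs.leftInvSeq ω) (cs.leftInvSeq ω') := by
      intro t t' hnc hs
      have ht : cs.IsReflection t := cs.isReflection_of_mem_leftInvSeq ω (hs.subset (by simp))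
      have ht' : cs.IsReflection t' := cs.isReflection_of_mem_leftInvSeq ω (hs.subset (by simp))
      obtain ⟨D, hD, htD, htD'⟩ := exists_max cs ht ht'
      have hncD : IsNonCommutative cs D := ⟨t, t', ht, ht', htD, htD', hnc⟩
      have hiff : FD cs D ω₀ ≠ FD cs D ω ↔ FD cs D ω₀ ≠ FD cs D ω' := by
        have h1 := inv_iff cs hw₀ hω₀ hω hω₀p hp D
        have h2 := inv_iff cs hw₀ hω₀ hω' hω₀p hp' D
        rw [hinv] at h1
        have h3 := h1.symm.trans h2
        simpa [hD, hncD] using h3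
      have hF : FD cs D ω = FD cs D ω' := by
        by_cases h : FD cs D ω₀ = FD cs D ω
        · have : FD cs D ω₀ = FD cs D ω' := by
            by_contra h'
            exact hiff.2 h' h
          exact h.symm.trans this
        · exact good_third cs hD.1 (fd_good cs D hω₀) (fd_good cs D hω) (fd_good cs D hω')
            (fd_len cs hw₀ D hω₀ hω hω₀p hp) (fd_len cs hw₀ D hω₀ hω' hω₀p hp') h (hiff.1 h)
      rw [fd_sublist cs _ htD htD', ← hF, ← fd_sublist cs _ htD htD']
      exact hs
    obtain ⟨ω'', h1, h2⟩ := comm_of_agree cs ω' ω hω hω' (fun x => by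
      rw [mem_lis_long cs hw₀ hp, mem_lis_long cs hw₀ hp']) hag
    rw [← pre_congr cs h2]
    exact rtg_sqEquiv cs hω h1
  · intro h
    obtain ⟨ω', hω', hp', rfl, hF⟩ := sqEquiv_word cs hw₀ hω hp h
    ext D
    rw [inv_iff cs hw₀ hω₀ hω hω₀p hp, inv_iff cs hw₀ hω₀ hω' hω₀p hp']
    refine and_congr_right fun hD => and_congr_right fun hnc => ?_
    rw [hF D hD.1 hnc]

end Final

end WeakChains

/-- Let `(W, S)` be a finite Coxeter system, `w₀` its longest element, and `ω₀` a
reduced word for `w₀`.  Two maximal chains `C`, `C'` of the right weak order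
have the same inversion set `inv_{ω₀}` (of non-commutative maximal dihedral
reflection subgroups ordered differently from `ω₀`) if and only if they are
square-equivalent. -/
theorem inv_eq_iff_sqEquiv {B W : Type*} [Group W]
    {M : CoxeterMatrix B} (cs : CoxeterSystem M W) [Finite W]
    (w₀ : W) (hw₀ : ∀ w : W, cs.length w ≤ cs.length w₀)
    (ω₀ : List B) (hω₀ : cs.IsReduced ω₀) (hω₀p : cs.wordProd ω₀ = w₀)
    (C C' : Set W)
    (hC : IsMaxChain (weakLE cs) C) (hC' : IsMaxChain (weakLE cs) C') :
    invSubgroups cs ω₀ C = invSubgroups cs ω₀ C' ↔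
      SqEquiv (weakLE cs) C C' := by
  exact WeakChains.main_thm cs w₀ hw₀ ω₀ hω₀ hω₀p C C' hC hC'
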